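/- arXiv:1110.0425 — 5 statements merged into one kernel-verified Lean document; each statement's English description precedes it below -/
import Mathlib

section
/- Separation inner bound: if a pmf P_{SXYŜ} on 𝒮×𝒳×𝒴×Ŝ factors as P_S(s)·P_{Ŝ|S}(ŝ|s)·P_X(x)·P_{Y|X}(y|x) (so that the pair (S,Ŝ) is independent of the pair (X,Y)) and satisfies I(S;Ŝ) ≤ I(X;Y), then P_{SXYŜ} is achievable with a noncausal encoder. -/
open scoped BigOperators

noncomputable section

/-- `p` is a probability mass function on the finite type `α`. -/
def IsPMF {α : Type*} [Fintype α] (p : α → ℝ) : Prop :=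
  (∀ a, 0 ≤ p a) ∧ (∑ a, p a) = 1

/-- Probability of the event `E` under the pmf `P`. -/
def prob {Ω : Type*} [Fintype Ω] (P : Ω → ℝ) (E : Set Ω) : ℝ :=
  ∑ ω, E.indicator P ω

/-- Probability that the random variable `f` takes the value `a`, under `P`. -/
def margProb {Ω A : Type*} [Fintype Ω] (P : Ω → ℝ) (f : Ω → A) (a : A) : ℝ :=
  prob P {ω | f ω = a}

/-- Mutual information `I(f;g)` (base-2 logarithms) of random variables `f`, `g`
defined on a finite probability space with pmf `P`. -/
def mutInfo {Ω A B : Type*} [Fintype Ω] [Fintype A] [Fintype B]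
    (P : Ω → ℝ) (f : Ω → A) (g : Ω → B) : ℝ :=
  ∑ a : A, ∑ b : B,
    margProb P (fun ω => (f ω, g ω)) (a, b) *
      Real.logb 2 (margProb P (fun ω => (f ω, g ω)) (a, b) /
        (margProb P f a * margProb P g b))

/-- Conditional mutual information `I(f;g|h)` (base-2 logarithms). -/
def condMutInfo {Ω A B C : Type*} [Fintype Ω] [Fintype A] [Fintype B] [Fintype C]
    (P : Ω → ℝ) (f : Ω → A) (g : Ω → B) (h : Ω → C) : ℝ :=
  ∑ a : A, ∑ b : B, ∑ c : C,
    margProb P (fun ω => (f ω, g ω, h ω)) (a, b, c) *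
      Real.logb 2
        ((margProb P (fun ω => (f ω, g ω, h ω)) (a, b, c) * margProb P h c) /
          (margProb P (fun ω => (f ω, h ω)) (a, c) *
            margProb P (fun ω => (g ω, h ω)) (b, c)))

/-- Total variation distance between two pmfs: half the ℓ¹ distance. -/
def tvDist {α : Type*} [Fintype α] (P Q : α → ℝ) : ℝ :=
  (∑ a, |P a - Q a|) / 2

/-- Empirical distribution of the sequence `w`. -/
def empDist {n : ℕ} {α : Type*} (w : Fin n → α) (a : α) : ℝ :=
  (∑ i : Fin n, ({i | w i = a} : Set (Fin n)).indicator (fun _ => (1 : ℝ)) i) / n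

/-- Causality classes for the encoder. -/
inductive EncoderClass | noncausal | causal | strictlyCausal

/-- The encoder `f` respects the causality class `c`:
a noncausal encoder has `Xᵢ = fᵢ(Sⁿ)`, a causal encoder has `Xᵢ = fᵢ(Sⁱ)`
(it only depends on `S₁,…,Sᵢ`), and a strictly causal encoder has
`Xᵢ = fᵢ(Sⁱ⁻¹)` (it only depends on `S₁,…,Sᵢ₋₁`). -/
def EncOK {n : ℕ} {S X : Type*} : EncoderClass → (Fin n → (Fin n → S) → X) → Prop
  | .noncausal, _ => True
  | .causal, f => ∀ (i : Fin n) (s s' : Fin n → S),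
      (∀ j, j ≤ i → s j = s' j) → f i s = f i s'
  | .strictlyCausal, f => ∀ (i : Fin n) (s s' : Fin n → S),
      (∀ j, j < i → s j = s' j) → f i s = f i s'

/-- The joint pmf of `(Sⁿ, Yⁿ)` induced by the i.i.d. source `PS`, the memoryless
channel `PYX` and the (deterministic) encoder `f`. -/
def inducedP {S X Y : Type*} {n : ℕ}
    (PS : S → ℝ) (PYX : X → Y → ℝ) (f : Fin n → (Fin n → S) → X) :
    (Fin n → S) × (Fin n → Y) → ℝ :=
  fun sy => (∏ i, PS (sy.1 i)) * ∏ i, PYX (f i sy.1) (sy.2 i)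

/-- `P` (a pmf on `S × X × Y × Z`) is achievable for the source `PS` and channel `PYX`
with an encoder of causality class `c`: for every `ε > 0` there are a block length
`n` and a block-`n` code such that with probability at least `1 - ε` the empirical
distribution of `(Sⁿ, Xⁿ, Yⁿ, Ŝⁿ)` is within total variation `ε` of `P`. -/
def Achievable {S X Y Z : Type*} [Fintype S] [Fintype X] [Fintype Y] [Fintype Z]
    (PS : S → ℝ) (PYX : X → Y → ℝ) (c : EncoderClass)
    (P : S × X × Y × Z → ℝ) : Prop :=
  ∀ ε : ℝ, 0 < ε →
    ∃ n : ℕ, 0 < n ∧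
      ∃ (f : Fin n → (Fin n → S) → X) (g : Fin n → (Fin n → Y) → Z),
        EncOK c f ∧
        prob (inducedP PS PYX f)
          {sy | ε <
            tvDist (empDist (fun i => (sy.1 i, f i sy.1, sy.2 i, g i sy.2))) P} < ε


/-! ### Finite product distributions -/

/-- The i.i.d. product of the weight function `p`. -/
def iidPMF {ι α : Type*} [Fintype ι] (p : α → ℝ) (w : ι → α) : ℝ :=
  ∏ i, p (w i)

/-- The `n`-fold memoryless extension of the kernel `W`. -/
def memoryless {ι α β : Type*} [Fintype ι] (W : α → β → ℝ) (x : ι → α) (y : ι → β) : ℝ :=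
  ∏ i, W (x i) (y i)

/-- The output distribution of the kernel `W` with input distribution `p`. -/
def outMarg {α β : Type*} [Fintype α] (p : α → ℝ) (W : α → β → ℝ) (b : β) : ℝ :=
  ∑ a, p a * W a b

theorem IsPMF.exists_le_of_sum_le {ι : Type*} [Fintype ι] {w c : ι → ℝ} {B : ℝ}
    (hw : IsPMF w) (h : ∑ i, w i * c i ≤ B) : ∃ i, c i ≤ B := by
  by_contra! hc
  obtain ⟨i, hi⟩ : ∃ i, 0 < w i := by
    by_contra! h0
    have := Finset.sum_nonpos fun i (_ : i ∈ Finset.univ) => h0 i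
    rw [hw.2] at this
    linarith
  have : ∑ i, w i * B < ∑ i, w i * c i :=
    Finset.sum_lt_sum (fun i _ => mul_le_mul_of_nonneg_left (hc i).le (hw.1 i))
      ⟨i, Finset.mem_univ i, mul_lt_mul_of_pos_left (hc i) hi⟩
  rw [← Finset.sum_mul, hw.2] at this
  linarith

theorem IsPMF.sum_kernel {α β : Type*} [Fintype α] [Fintype β] {p : α → ℝ} {W : α → β → ℝ}
    (hp : IsPMF p) (hW : ∀ a, IsPMF (W a)) : ∑ a, ∑ b, p a * W a b = 1 := by
  simp [← Finset.mul_sum, (hW _).2, hp.2]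

theorem IsPMF.outMarg {α β : Type*} [Fintype α] [Fintype β] {p : α → ℝ} {W : α → β → ℝ}
    (hp : IsPMF p) (hW : ∀ a, IsPMF (W a)) : IsPMF (outMarg p W) := by
  refine ⟨fun b => Finset.sum_nonneg fun a _ => mul_nonneg (hp.1 a) ((hW a).1 b), ?_⟩
  unfold _root_.outMarg
  rw [Finset.sum_comm, hp.sum_kernel hW]

theorem IsPMF.joint {α β : Type*} [Fintype α] [Fintype β] {p : α → ℝ} {W : α → β → ℝ}
    (hp : IsPMF p) (hW : ∀ a, IsPMF (W a)) : IsPMF fun ab : α × β => p ab.1 * W ab.1 ab.2 :=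
  ⟨fun ab => mul_nonneg (hp.1 _) ((hW _).1 _), by
    rw [Fintype.sum_prod_type]; exact hp.sum_kernel hW⟩

theorem sum_prod_apply {ι α : Type*} [Fintype ι] [DecidableEq ι] [Fintype α] (φ : ι → α → ℝ) :
    ∑ w : ι → α, ∏ i, φ i (w i) = ∏ i, ∑ a, φ i a := by
  rw [Finset.prod_univ_sum, Fintype.piFinset_univ]

theorem IsPMF.iid {ι α : Type*} [Fintype ι] [DecidableEq ι] [Fintype α] {p : α → ℝ} (hp : IsPMF p) :
    IsPMF (iidPMF (ι := ι) p) := by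
  refine ⟨fun w => Finset.prod_nonneg fun i _ => hp.1 _, ?_⟩
  unfold iidPMF
  rw [sum_prod_apply fun _ => p]
  simp [hp.2]

theorem IsPMF.memoryless {ι α β : Type*} [Fintype ι] [DecidableEq ι] [Fintype β] {W : α → β → ℝ}
    (hW : ∀ a, IsPMF (W a)) (x : ι → α) : IsPMF (memoryless W x) := by
  refine ⟨fun w => Finset.prod_nonneg fun i _ => (hW _).1 _, ?_⟩
  unfold _root_.memoryless
  rw [sum_prod_apply fun i => W (x i)]
  simp [(hW _).2]

theorem outMarg_memoryless {ι α β : Type*} [Fintype ι] [DecidableEq ι] [Fintype α] (p : α → ℝ)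
    (W : α → β → ℝ) (y : ι → β) :
    outMarg (iidPMF p) (memoryless W) y = iidPMF (outMarg p W) y := by
  simp only [outMarg, iidPMF, memoryless, ← Finset.prod_mul_distrib]
  rw [sum_prod_apply fun i a => p a * W a (y i)]

theorem sum_iidPMF_mul_apply_mul_apply {ι α : Type*} [Fintype ι] [DecidableEq ι] [Fintype α] {p : α → ℝ}
    (hp : IsPMF p) (φ ψ : α → ℝ) {i j : ι} (hij : i ≠ j) :
    ∑ w, iidPMF p w * (φ (w i) * ψ (w j)) = (∑ a, p a * φ a) * ∑ a, p a * ψ a := by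
  have key := sum_prod_apply fun (k : ι) (a : α) =>
    p a * ((if k = i then φ a else 1) * (if k = j then ψ a else 1))
  simp only [Finset.prod_mul_distrib, Finset.prod_ite_eq', Finset.mem_univ, if_true] at key
  unfold iidPMF
  rw [key, ← Finset.prod_subset (Finset.subset_univ {i, j}), Finset.prod_pair hij]
  · simp [hij, hij.symm]
  · intro k _ hk
    simp only [Finset.mem_insert, Finset.mem_singleton, not_or] at hk
    simp [hk.1, hk.2, hp.2]

theorem sum_iidPMF_mul_apply {ι α : Type*} [Fintype ι] [DecidableEq ι] [Fintype α] {p : α → ℝ}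
    (hp : IsPMF p) (φ : α → ℝ) (i : ι) :
    ∑ w, iidPMF p w * φ (w i) = ∑ a, p a * φ a := by
  have key := sum_prod_apply fun (k : ι) (a : α) => p a * (if k = i then φ a else 1)
  simp only [Finset.prod_mul_distrib, Finset.prod_ite_eq', Finset.mem_univ, if_true] at key
  unfold iidPMF
  rw [key, Finset.prod_eq_single i]
  · simp
  · intro k _ hk
    simp [hk, hp.2]
  · simp

/-! ### The weak law of large numbers -/

theorem sum_iidPMF_mul_sq {α : Type*} [Fintype α] {p : α → ℝ} (hp : IsPMF p) {g : α → ℝ}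
    (hg : ∑ a, p a * g a = 0) (n : ℕ) :
    ∑ w : Fin n → α, iidPMF p w * (∑ i, g (w i)) ^ 2 = n * ∑ a, p a * g a ^ 2 := by
  have h : ∀ i j : Fin n, ∑ w : Fin n → α, iidPMF p w * (g (w i) * g (w j)) =
      if i = j then ∑ a, p a * g a ^ 2 else 0 := by
    intro i j
    split_ifs with hij
    · subst hij
      simp_rw [← sq]
      exact sum_iidPMF_mul_apply hp (fun a => g a ^ 2) i
    · rw [sum_iidPMF_mul_apply_mul_apply hp g g hij, hg, zero_mul]
  simp_rw [sq (∑ i, g _), Finset.sum_mul_sum, Finset.mul_sum]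
  rw [Finset.sum_comm]
  simp_rw [Finset.sum_comm (s := (Finset.univ : Finset (Fin n → α))), h]
  simp [Finset.mul_sum]

open Classical in
theorem tendsto_iidPMF_deviation {α : Type*} [Fintype α] {p : α → ℝ} (hp : IsPMF p) (h : α → ℝ)
    {ε : ℝ} (hε : 0 < ε) :
    Filter.Tendsto (fun n : ℕ => ∑ w : Fin n → α, iidPMF p w *
      (if n * ε ≤ |∑ i, h (w i) - n * ∑ a, p a * h a| then 1 else 0))
      Filter.atTop (nhds 0) := by
  set μ := ∑ a, p a * h a with hμ
  set v := ∑ a, p a * (h a - μ) ^ 2 with hv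
  have hlim : Filter.Tendsto (fun n : ℕ => v / ε ^ 2 / (n : ℝ)) Filter.atTop (nhds 0) :=
    tendsto_const_div_atTop_nhds_zero_nat _
  refine squeeze_zero' (Filter.Eventually.of_forall fun n => Finset.sum_nonneg fun w _ =>
    mul_nonneg (hp.iid.1 w) (by split_ifs <;> norm_num)) ?_ hlim
  filter_upwards [Filter.eventually_gt_atTop 0] with n hn
  have hn' : (0 : ℝ) < n := by exact_mod_cast hn
  have hsq := sum_iidPMF_mul_sq hp (g := fun a => h a - μ)
    (by simp [mul_sub, Finset.sum_sub_distrib, ← Finset.sum_mul, hp.2, ← hμ]) n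
  have hle : ∑ w : Fin n → α, iidPMF p w *
      (if n * ε ≤ |∑ i, h (w i) - n * μ| then 1 else 0) ≤
      ∑ w : Fin n → α, iidPMF p w * ((∑ i, (h (w i) - μ)) ^ 2 / (n * ε) ^ 2) := by
    refine Finset.sum_le_sum fun w _ => mul_le_mul_of_nonneg_left ?_ (hp.iid.1 w)
    have : ∑ i, (h (w i) - μ) = ∑ i, h (w i) - n * μ := by simp [Finset.sum_sub_distrib]
    rw [this]
    split_ifs with hc
    · rw [le_div_iff₀ (by positivity), one_mul, ← sq_abs (∑ i, h (w i) - n * μ)]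
      exact pow_le_pow_left₀ (by positivity) hc 2
    · positivity
  refine hle.trans (le_of_eq ?_)
  simp_rw [mul_div_assoc', ← Finset.sum_div]
  rw [hsq]
  field_simp
  exact hv.symm

open Classical in
theorem tendsto_iidPMF_tvDist_empDist {α : Type*} [Fintype α] {p : α → ℝ} (hp : IsPMF p)
    {ε : ℝ} (hε : 0 < ε) :
    Filter.Tendsto (fun n : ℕ => ∑ w : Fin n → α, iidPMF p w *
      (if ε < tvDist (empDist w) p then 1 else 0)) Filter.atTop (nhds 0) := by
  set ε' := ε / (Fintype.card α + 1) with hε'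
  have hε'0 : 0 < ε' := by positivity
  have hlim := tendsto_finsetSum (Finset.univ : Finset α) fun a _ =>
    tendsto_iidPMF_deviation hp (fun b => if b = a then (1 : ℝ) else 0) hε'0
  simp only [Finset.sum_const_zero] at hlim
  refine squeeze_zero' (Filter.Eventually.of_forall fun n => Finset.sum_nonneg fun w _ =>
    mul_nonneg (hp.iid.1 w) (by split_ifs <;> norm_num)) ?_ hlim
  filter_upwards [Filter.eventually_gt_atTop 0] with n hn
  have hn' : (0 : ℝ) < n := by exact_mod_cast hn
  rw [Finset.sum_comm]
  refine Finset.sum_le_sum fun w _ => ?_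
  rw [← Finset.mul_sum]
  refine mul_le_mul_of_nonneg_left ?_ (hp.iid.1 w)
  split_ifs with hc
  · obtain ⟨a, ha⟩ : ∃ a, ε' ≤ |empDist w a - p a| := by
      by_contra! hlt
      have h1 : ∑ a, |empDist w a - p a| ≤ ∑ _a : α, ε' :=
        Finset.sum_le_sum fun a _ => (hlt a).le
      rw [Finset.sum_const, Finset.card_univ, nsmul_eq_mul] at h1
      have h2 : (Fintype.card α + 1) * ε' = ε := by rw [hε']; field_simp
      unfold tvDist at hc
      linarith
    refine le_trans ?_ (Finset.single_le_sum (fun b _ => ?_) (Finset.mem_univ a))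
    · rw [if_pos]
      have he : empDist w a = (∑ i, if w i = a then (1 : ℝ) else 0) / n := by
        simp [empDist, Set.indicator_apply]
      have : ∑ b, p b * (if b = a then (1 : ℝ) else 0) = p a := by simp
      rw [this]
      calc n * ε' ≤ n * |empDist w a - p a| := by gcongr
        _ = |n * (empDist w a - p a)| := by rw [abs_mul, abs_of_pos hn']
        _ = _ := by rw [he]; congr 1; field_simp
    · split_ifs <;> norm_num
  · exact Finset.sum_nonneg fun b _ => by split_ifs <;> norm_num

/-! ### Random coding for a single use -/

open Classical in
/-- Covering by a random codebook. -/
theorem exists_covering_codebook {U Z : Type*} [Fintype U] [Fintype Z] {pS : U → ℝ}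
    {V : U → Z → ℝ} (hS : IsPMF pS) (hV : ∀ u, IsPMF (V u)) (F : U → Z → Prop) {γ : ℝ}
    (hγ : 0 < γ) (hF : ∀ u z, F u z → V u z ≤ γ * outMarg pS V z) {M : ℕ} (hM : 0 < M) :
    ∃ (z : Fin M → Z) (m : U → Fin M),
      ∑ u, pS u * (if F u (z (m u)) then 0 else 1) ≤
        ∑ u, ∑ z, pS u * V u z * (if F u z then 0 else 1) + Real.exp (-(M / γ)) := by
  have hZ := hS.outMarg hV
  set q := outMarg pS V with hq
  have hbound : ∀ u, (∑ z, q z * (if F u z then 0 else 1)) ^ M ≤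
      ∑ z, V u z * (if F u z then 0 else 1) + Real.exp (-(M / γ)) := by
    intro u
    have hcompl : ∀ r : Z → ℝ, IsPMF r → ∑ z, r z * (if F u z then 0 else 1) =
        1 - ∑ z, r z * (if F u z then 1 else 0) := by
      intro r hr
      rw [eq_sub_iff_add_eq, ← Finset.sum_add_distrib]
      refine (Finset.sum_congr rfl fun z _ => ?_).trans hr.2
      split_ifs <;> ring
    have hpos : ∀ r : Z → ℝ, IsPMF r → 0 ≤ ∑ z, r z * (if F u z then 1 else 0) ∧
        0 ≤ ∑ z, r z * (if F u z then 0 else 1) := fun r hr =>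
      ⟨Finset.sum_nonneg fun z _ => mul_nonneg (hr.1 z) (by split_ifs <;> norm_num),
        Finset.sum_nonneg fun z _ => mul_nonneg (hr.1 z) (by split_ifs <;> norm_num)⟩
    have hVle : ∑ z, V u z * (if F u z then 1 else 0) ≤
        γ * ∑ z, q z * (if F u z then 1 else 0) := by
      rw [Finset.mul_sum]
      refine Finset.sum_le_sum fun z _ => ?_
      split_ifs with h
      · simpa using hF u z h
      · simp
    have hV1 := hcompl _ (hV u)
    have hV2 := hpos _ (hV u)
    have hq1 := hcompl _ hZ
    have hq2 := hpos _ hZ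
    set a := ∑ z, V u z * (if F u z then 1 else 0)
    set a' := ∑ z, V u z * (if F u z then 0 else 1)
    set b := ∑ z, q z * (if F u z then 1 else 0)
    set b' := ∑ z, q z * (if F u z then 0 else 1)
    have hb : a / γ ≤ b := by rw [div_le_iff₀ hγ]; linarith
    have h1 : b' ≤ Real.exp (-(a / γ)) := by
      have := Real.add_one_le_exp (-(a / γ))
      linarith
    have h2 : b' ^ M ≤ Real.exp (a' * 0 + a * -(M / γ)) := by
      refine (pow_le_pow_left₀ hq2.2 h1 M).trans (le_of_eq ?_)
      rw [← Real.exp_nat_mul]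
      congr 1
      ring
    have h3 := convexOn_exp.2 (Set.mem_univ (0 : ℝ)) (Set.mem_univ (-(M / γ))) hV2.2 hV2.1
      (by linarith)
    simp only [smul_eq_mul, Real.exp_zero, mul_one] at h3
    have h4 : a * Real.exp (-(M / γ)) ≤ Real.exp (-(M / γ)) :=
      mul_le_of_le_one_left (Real.exp_pos _).le (by linarith)
    linarith
  have havg : ∑ z : Fin M → Z, iidPMF q z * ∑ u, pS u * ∏ m, (if F u (z m) then (0 : ℝ) else 1) ≤
      ∑ u, ∑ z, pS u * V u z * (if F u z then 0 else 1) + Real.exp (-(M / γ)) := by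
    have hcomp : ∀ u, ∑ z : Fin M → Z, iidPMF q z * ∏ m, (if F u (z m) then (0 : ℝ) else 1) =
        (∑ z, q z * (if F u z then 0 else 1)) ^ M := by
      intro u
      simp only [iidPMF, ← Finset.prod_mul_distrib]
      rw [sum_prod_apply fun _ z => q z * (if F u z then 0 else 1)]
      simp
    calc _ = ∑ u, pS u * (∑ z, q z * (if F u z then 0 else 1)) ^ M := by
          simp_rw [← hcomp, Finset.mul_sum]
          rw [Finset.sum_comm]
          refine Finset.sum_congr rfl fun u _ => Finset.sum_congr rfl fun z _ => ?_
          ring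
      _ ≤ ∑ u, pS u * (∑ z, V u z * (if F u z then 0 else 1) + Real.exp (-(M / γ))) :=
          Finset.sum_le_sum fun u _ => mul_le_mul_of_nonneg_left (hbound u) (hS.1 u)
      _ = _ := by
          simp_rw [mul_add, Finset.sum_add_distrib, ← Finset.sum_mul, hS.2, one_mul,
            Finset.mul_sum, mul_assoc]
  obtain ⟨z, hz⟩ := hZ.iid.exists_le_of_sum_le havg
  refine ⟨z, fun u => if h : ∃ m, F u (z m) then h.choose else ⟨0, hM⟩, le_trans ?_ hz⟩
  refine Finset.sum_le_sum fun u _ => mul_le_mul_of_nonneg_left ?_ (hS.1 u)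
  by_cases h : ∃ m, F u (z m)
  · simp only [h, dif_pos, h.choose_spec, if_true]
    exact Finset.prod_nonneg fun m _ => by split_ifs <;> norm_num
  · push Not at h
    simp [h]

open Classical in
/-- Channel coding with a random codebook and threshold decoding, for a fixed assignment `m` of
messages and a cost `c` incurred by the decoded message. -/
theorem exists_channel_codebook {U X Y : Type*} [Fintype U] [Fintype X] [Fintype Y]
    {pS : U → ℝ} {pX : X → ℝ} {W : X → Y → ℝ} (hS : IsPMF pS) (hX : IsPMF pX)
    (hW : ∀ x, IsPMF (W x)) {M : ℕ} (m : U → Fin M) (hM : 0 < M)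
    {c : U → X → Y → Fin M → ℝ} (hc0 : ∀ u x y k, 0 ≤ c u x y k) (hc1 : ∀ u x y k, c u x y k ≤ 1)
    {γ : ℝ} (hγ : 0 < γ) :
    ∃ (x : Fin M → X) (d : Y → Fin M),
      ∑ u, ∑ y, pS u * W (x (m u)) y * c u (x (m u)) y (d y) ≤
        ∑ u, pS u * ∑ x, ∑ y, pX x * W x y * c u x y (m u) +
        ∑ x, ∑ y, pX x * W x y * (if W x y ≤ γ * outMarg pX W y then 1 else 0) +
        (M - 1) / γ := by
  have hY := hX.outMarg hW
  set q := outMarg pX W with hq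
  set D : X → Y → ℝ := fun x y => if W x y ≤ γ * q y then 0 else 1 with hD
  set D' : X → Y → ℝ := fun x y => if W x y ≤ γ * q y then 1 else 0 with hD'
  let d : (Fin M → X) → Y → Fin M := fun x y =>
    if h : ∃ k, γ * q y < W (x k) y then h.choose else ⟨0, hM⟩
  have hD0 : ∀ x y, 0 ≤ D x y := fun x y => by simp only [hD]; split_ifs <;> norm_num
  have hD'0 : ∀ x y, 0 ≤ D' x y := fun x y => by simp only [hD']; split_ifs <;> norm_num
  have hpoint : ∀ (x : Fin M → X) u y, c u (x (m u)) y (d x y) ≤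
      c u (x (m u)) y (m u) + D' (x (m u)) y + ∑ k ∈ Finset.univ.erase (m u), D (x k) y := by
    intro x u y
    have hsum0 : 0 ≤ ∑ k ∈ Finset.univ.erase (m u), D (x k) y :=
      Finset.sum_nonneg fun k _ => hD0 _ _
    by_cases hm : W (x (m u)) y ≤ γ * q y
    · have : D' (x (m u)) y = 1 := by simp [hD', hm]
      linarith [hc0 u (x (m u)) y (m u), hc1 u (x (m u)) y (d x y)]
    · have hex : ∃ k, γ * q y < W (x k) y := ⟨m u, not_le.mp hm⟩
      have hd : γ * q y < W (x (d x y)) y := by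
        simp only [d, hex, dif_pos]
        exact hex.choose_spec
      by_cases he : d x y = m u
      · rw [he]
        linarith [hD'0 (x (m u)) y]
      · have h1 : D (x (d x y)) y = 1 := by simp [hD, hd]
        have h2 := Finset.single_le_sum (f := fun k => D (x k) y) (fun k _ => hD0 (x k) y)
          (Finset.mem_erase.mpr ⟨he, Finset.mem_univ (d x y)⟩)
        simp only [h1] at h2
        linarith [hc0 u (x (m u)) y (m u), hc1 u (x (m u)) y (d x y), hD'0 (x (m u)) y]
  have hfalse : ∑ y, q y * ∑ x, pX x * D x y ≤ 1 / γ := by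
    calc ∑ y, q y * ∑ x, pX x * D x y ≤ ∑ y, ∑ x, pX x * W x y / γ := by
          refine Finset.sum_le_sum fun y _ => ?_
          rw [Finset.mul_sum]
          refine Finset.sum_le_sum fun x _ => ?_
          have hnn := mul_nonneg (hX.1 x) ((hW x).1 y)
          simp only [hD]
          split_ifs with h
          · simp only [mul_zero]
            positivity
          · rw [le_div_iff₀ hγ]
            nlinarith [mul_le_mul_of_nonneg_left (not_le.mp h).le (hX.1 x)]
      _ = 1 / γ := by
          rw [Finset.sum_comm]
          simp_rw [← Finset.sum_div]
          rw [hX.sum_kernel hW]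
  have huser : ∀ u, ∑ x : Fin M → X, iidPMF pX x * ∑ y, W (x (m u)) y *
        (c u (x (m u)) y (m u) + D' (x (m u)) y + ∑ k ∈ Finset.univ.erase (m u), D (x k) y) ≤
      ∑ x, ∑ y, pX x * W x y * c u x y (m u) + ∑ x, ∑ y, pX x * W x y * D' x y +
        (M - 1) / γ := by
    intro u
    have h1 := sum_iidPMF_mul_apply hX (fun x => ∑ y, W x y * c u x y (m u)) (m u)
    have h2 := sum_iidPMF_mul_apply hX (fun x => ∑ y, W x y * D' x y) (m u)
    have h3 : ∑ x : Fin M → X, iidPMF pX x * ∑ y, W (x (m u)) y *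
        ∑ k ∈ Finset.univ.erase (m u), D (x k) y ≤ (M - 1) / γ := by
      calc _ = ∑ k ∈ Finset.univ.erase (m u), ∑ y, ∑ x : Fin M → X,
            iidPMF pX x * (W (x (m u)) y * D (x k) y) := by
            simp_rw [Finset.mul_sum]
            rw [Finset.sum_comm]
            simp_rw [Finset.sum_comm (s := (Finset.univ : Finset (Fin M → X)))]
            rw [Finset.sum_comm]
        _ = ∑ k ∈ Finset.univ.erase (m u), ∑ y, q y * ∑ x, pX x * D x y := by
            refine Finset.sum_congr rfl fun k hk => Finset.sum_congr rfl fun y _ => ?_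
            exact sum_iidPMF_mul_apply_mul_apply hX (fun x => W x y) (fun x => D x y)
              (Finset.ne_of_mem_erase hk).symm
        _ ≤ ∑ k ∈ Finset.univ.erase (m u), 1 / γ := Finset.sum_le_sum fun k _ => hfalse
        _ = (M - 1) / γ := by
            rw [Finset.sum_const, Finset.card_erase_of_mem (Finset.mem_univ _), Finset.card_univ,
              Fintype.card_fin, nsmul_eq_mul, Nat.cast_sub hM]
            simp [div_eq_mul_inv]
    simp only [mul_add, Finset.sum_add_distrib]
    rw [h1, h2]
    simp only [Finset.mul_sum, ← mul_assoc] at h3 ⊢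
    linarith
  have havg : ∑ x : Fin M → X, iidPMF pX x *
      ∑ u, ∑ y, pS u * W (x (m u)) y * c u (x (m u)) y (d x y) ≤
        ∑ u, pS u * ∑ x, ∑ y, pX x * W x y * c u x y (m u) +
        ∑ x, ∑ y, pX x * W x y * D' x y + (M - 1) / γ := by
    calc _ ≤ ∑ x : Fin M → X, iidPMF pX x * ∑ u, pS u * ∑ y, W (x (m u)) y *
          (c u (x (m u)) y (m u) + D' (x (m u)) y +
            ∑ k ∈ Finset.univ.erase (m u), D (x k) y) := by
          refine Finset.sum_le_sum fun x _ => mul_le_mul_of_nonneg_left ?_ (hX.iid.1 x)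
          refine Finset.sum_le_sum fun u _ => ?_
          rw [Finset.mul_sum]
          refine Finset.sum_le_sum fun y _ => ?_
          rw [mul_assoc]
          exact mul_le_mul_of_nonneg_left
            (mul_le_mul_of_nonneg_left (hpoint x u y) ((hW _).1 y)) (hS.1 u)
      _ = ∑ u, pS u * ∑ x : Fin M → X, iidPMF pX x * ∑ y, W (x (m u)) y *
          (c u (x (m u)) y (m u) + D' (x (m u)) y +
            ∑ k ∈ Finset.univ.erase (m u), D (x k) y) := by
          simp_rw [Finset.mul_sum (s := (Finset.univ : Finset U)),
            Finset.mul_sum (s := (Finset.univ : Finset (Fin M → X)))]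
          rw [Finset.sum_comm]
          refine Finset.sum_congr rfl fun u _ => Finset.sum_congr rfl fun x _ => ?_
          ring
      _ ≤ ∑ u, pS u * (∑ x, ∑ y, pX x * W x y * c u x y (m u) +
            ∑ x, ∑ y, pX x * W x y * D' x y + (M - 1) / γ) :=
          Finset.sum_le_sum fun u _ => mul_le_mul_of_nonneg_left (huser u) (hS.1 u)
      _ = _ := by
          simp only [mul_add, Finset.sum_add_distrib, ← Finset.sum_mul, hS.2, one_mul]
  obtain ⟨x, hx⟩ := hX.iid.exists_le_of_sum_le havg
  exact ⟨x, d x, hx⟩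

open Classical in
/-- Joint source-channel code obtained by concatenating random source and channel codes. -/
theorem exists_separation_code {U X Y Z : Type*} [Fintype U] [Fintype X] [Fintype Y] [Fintype Z]
    {pS : U → ℝ} {V : U → Z → ℝ} {pX : X → ℝ} {W : X → Y → ℝ} (hS : IsPMF pS)
    (hV : ∀ u, IsPMF (V u)) (hX : IsPMF pX) (hW : ∀ x, IsPMF (W x))
    {c : U → X → Y → Z → ℝ} (hc0 : ∀ u x y z, 0 ≤ c u x y z) (hc1 : ∀ u x y z, c u x y z ≤ 1)
    {M : ℕ} (hM : 0 < M) {β γ₁ γ₂ : ℝ} (hβ : 0 < β) (hγ₁ : 0 < γ₁) (hγ₂ : 0 < γ₂) :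
    ∃ (f : U → X) (g : Y → Z),
      ∑ u, ∑ y, pS u * W (f u) y * c u (f u) y (g y) ≤
        β + (∑ u, ∑ z, ∑ x, ∑ y, pS u * V u z * (pX x * W x y) * c u x y z) / β +
        ∑ u, ∑ z, pS u * V u z * (if γ₁ * outMarg pS V z < V u z then 1 else 0) +
        Real.exp (-(M / γ₁)) +
        ∑ x, ∑ y, pX x * W x y * (if W x y ≤ γ₂ * outMarg pX W y then 1 else 0) +
        (M - 1) / γ₂ := by
  set b : U → Z → ℝ := fun u z => ∑ x, ∑ y, pX x * W x y * c u x y z with hb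
  have hb0 : ∀ u z, 0 ≤ b u z := fun u z => Finset.sum_nonneg fun x _ => Finset.sum_nonneg
    fun y _ => mul_nonneg (mul_nonneg (hX.1 x) ((hW x).1 y)) (hc0 u x y z)
  have hb1 : ∀ u z, b u z ≤ 1 := by
    intro u z
    rw [← hX.sum_kernel hW]
    exact Finset.sum_le_sum fun x _ => Finset.sum_le_sum fun y _ =>
      mul_le_of_le_one_right (mul_nonneg (hX.1 x) ((hW x).1 y)) (hc1 u x y z)
  obtain ⟨z, m, hz⟩ := exists_covering_codebook hS hV
    (fun u z => b u z ≤ β ∧ V u z ≤ γ₁ * outMarg pS V z) hγ₁ (fun u z h => h.2) hM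
  obtain ⟨x, d, hx⟩ := exists_channel_codebook hS hX hW m hM
    (c := fun u x y k => c u x y (z k)) (fun u x y k => hc0 _ _ _ _) (fun u x y k => hc1 _ _ _ _)
    hγ₂
  refine ⟨fun u => x (m u), fun y => z (d y), hx.trans ?_⟩
  have h1 : ∑ u, pS u * b u (z (m u)) ≤ β + ∑ u, pS u *
      (if b u (z (m u)) ≤ β ∧ V u (z (m u)) ≤ γ₁ * outMarg pS V (z (m u)) then 0 else 1) := by
    calc _ ≤ ∑ u, pS u * (β +
        (if b u (z (m u)) ≤ β ∧ V u (z (m u)) ≤ γ₁ * outMarg pS V (z (m u)) then 0 else 1)) := by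
          refine Finset.sum_le_sum fun u _ => mul_le_mul_of_nonneg_left ?_ (hS.1 u)
          split_ifs with h
          · linarith [h.1]
          · linarith [hb1 u (z (m u))]
      _ = _ := by simp only [mul_add, Finset.sum_add_distrib, ← Finset.sum_mul, hS.2, one_mul]
  have h2 : ∑ u, ∑ z, pS u * V u z *
        (if b u z ≤ β ∧ V u z ≤ γ₁ * outMarg pS V z then 0 else 1) ≤
      (∑ u, ∑ z, ∑ x, ∑ y, pS u * V u z * (pX x * W x y) * c u x y z) / β +
      ∑ u, ∑ z, pS u * V u z * (if γ₁ * outMarg pS V z < V u z then 1 else 0) := by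
    have hrw : ∑ u, ∑ z, ∑ x, ∑ y, pS u * V u z * (pX x * W x y) * c u x y z =
        ∑ u, ∑ z, pS u * V u z * b u z := by
      simp only [hb, Finset.mul_sum, mul_assoc]
    rw [hrw, Finset.sum_div, ← Finset.sum_add_distrib]
    refine Finset.sum_le_sum fun u _ => ?_
    rw [Finset.sum_div, ← Finset.sum_add_distrib]
    refine Finset.sum_le_sum fun z _ => ?_
    rw [mul_div_assoc, ← mul_add]
    refine mul_le_mul_of_nonneg_left ?_ (mul_nonneg (hS.1 u) ((hV u).1 z))
    have hdiv : 0 ≤ b u z / β := div_nonneg (hb0 u z) hβ.le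
    by_cases hg : γ₁ * outMarg pS V z < V u z
    · simp [hg, not_le.mpr hg, hdiv]
    · by_cases hbz : b u z ≤ β
      · simp [hbz, not_lt.mp hg, hg, hdiv]
      · have : 1 ≤ b u z / β := by rw [le_div_iff₀ hβ]; linarith
        simpa [hbz, hg] using this
  simp only [hb] at h1 h2 hz
  linarith

/-! ### Mutual information of an input distribution and a kernel -/

/-- Mutual information (in nats) between the input and the output of the kernel `W` with input
distribution `p`. -/
def kernelInfo {α β : Type*} [Fintype α] [Fintype β] (p : α → ℝ) (W : α → β → ℝ) : ℝ :=
  ∑ a, ∑ b, p a * W a b * Real.log (W a b / outMarg p W b)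

section KernelInfo

variable {α β : Type*} [Fintype α] [Fintype β] {p : α → ℝ} {W : α → β → ℝ}

theorem mul_le_outMarg (hp : IsPMF p) (hW : ∀ a, IsPMF (W a)) (a : α) (b : β) :
    p a * W a b ≤ outMarg p W b :=
  Finset.single_le_sum (f := fun a => p a * W a b)
    (fun a _ => mul_nonneg (hp.1 a) ((hW a).1 b)) (Finset.mem_univ a)

theorem mul_eq_zero_of_outMarg_eq_zero (hp : IsPMF p) (hW : ∀ a, IsPMF (W a)) (a : α) {b : β}
    (hb : outMarg p W b = 0) : p a * W a b = 0 :=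
  le_antisymm (hb ▸ mul_le_outMarg hp hW a b) (mul_nonneg (hp.1 a) ((hW a).1 b))

theorem kernelInfo_eq_sum_klFun (hp : IsPMF p) (hW : ∀ a, IsPMF (W a)) :
    kernelInfo p W =
      ∑ a, ∑ b, p a * outMarg p W b * InformationTheory.klFun (W a b / outMarg p W b) := by
  have hq := hp.outMarg hW
  have h1 : ∑ a, ∑ b, p a * outMarg p W b = 1 := hp.sum_kernel fun _ => hq
  have h2 := hp.sum_kernel hW
  have h3 : ∑ a, ∑ b, p a * outMarg p W b * InformationTheory.klFun (W a b / outMarg p W b) =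
      kernelInfo p W + ∑ a, ∑ b, p a * outMarg p W b - ∑ a, ∑ b, p a * W a b := by
    simp only [kernelInfo, ← Finset.sum_add_distrib, ← Finset.sum_sub_distrib]
    refine Finset.sum_congr rfl fun a _ => Finset.sum_congr rfl fun b _ => ?_
    by_cases hb : outMarg p W b = 0
    · simp [hb, mul_eq_zero_of_outMarg_eq_zero hp hW a hb]
    · rw [InformationTheory.klFun]
      field_simp
  rw [h3, h1, h2]
  ring

theorem kernelInfo_term_nonneg (hp : IsPMF p) (hW : ∀ a, IsPMF (W a)) (a : α) (b : β) :
    0 ≤ p a * outMarg p W b * InformationTheory.klFun (W a b / outMarg p W b) :=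
  mul_nonneg (mul_nonneg (hp.1 a) ((hp.outMarg hW).1 b))
    (InformationTheory.klFun_nonneg (div_nonneg ((hW a).1 b) ((hp.outMarg hW).1 b)))

theorem kernelInfo_nonneg (hp : IsPMF p) (hW : ∀ a, IsPMF (W a)) : 0 ≤ kernelInfo p W := by
  rw [kernelInfo_eq_sum_klFun hp hW]
  exact Finset.sum_nonneg fun a _ => Finset.sum_nonneg fun b _ => kernelInfo_term_nonneg hp hW a b

theorem mul_eq_mul_outMarg_of_kernelInfo_eq_zero (hp : IsPMF p) (hW : ∀ a, IsPMF (W a))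
    (h : kernelInfo p W = 0) (a : α) (b : β) : p a * W a b = p a * outMarg p W b := by
  rw [kernelInfo_eq_sum_klFun hp hW, Finset.sum_eq_zero_iff_of_nonneg fun a _ =>
    Finset.sum_nonneg fun b _ => kernelInfo_term_nonneg hp hW a b] at h
  have h' := h a (Finset.mem_univ a)
  rw [Finset.sum_eq_zero_iff_of_nonneg fun b _ => kernelInfo_term_nonneg hp hW a b] at h'
  have h'' := h' b (Finset.mem_univ b)
  rcases mul_eq_zero.mp h'' with h0 | h0
  · rcases mul_eq_zero.mp h0 with hpa | hb
    · simp [hpa]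
    · rw [hb, mul_eq_zero_of_outMarg_eq_zero hp hW a hb, mul_zero]
  · rw [InformationTheory.klFun_eq_zero_iff
      (div_nonneg ((hW a).1 b) ((hp.outMarg hW).1 b))] at h0
    have hb : outMarg p W b ≠ 0 := fun hb => by simp [hb] at h0
    rw [(div_eq_one_iff_eq hb).mp h0]

/-- The kernel `W` mixed with its output distribution. -/
def mixKernel (p : α → ℝ) (W : α → β → ℝ) (t : ℝ) (a : α) (b : β) : ℝ :=
  (1 - t) * W a b + t * outMarg p W b

theorem IsPMF.mixKernel (hp : IsPMF p) (hW : ∀ a, IsPMF (W a)) {t : ℝ} (ht0 : 0 ≤ t)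
    (ht1 : t ≤ 1) (a : α) : IsPMF (mixKernel p W t a) := by
  refine ⟨fun b => add_nonneg (mul_nonneg (by linarith) ((hW a).1 b))
    (mul_nonneg ht0 ((hp.outMarg hW).1 b)), ?_⟩
  simp only [_root_.mixKernel, Finset.sum_add_distrib, ← Finset.mul_sum, (hW a).2,
    (hp.outMarg hW).2]
  ring

theorem outMarg_mixKernel {α β : Type*} [Fintype α] {p : α → ℝ} {W : α → β → ℝ} (hp : IsPMF p)
    (t : ℝ) : outMarg p (mixKernel p W t) = outMarg p W := by
  funext b
  have : ∀ a, p a * mixKernel p W t a b = (1 - t) * (p a * W a b) + p a * (t * outMarg p W b) :=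
    fun a => by unfold mixKernel; ring
  rw [outMarg]
  simp only [this, Finset.sum_add_distrib, ← Finset.mul_sum, ← Finset.sum_mul, hp.2]
  rw [← outMarg]
  ring

theorem kernelInfo_mixKernel_le (hp : IsPMF p) (hW : ∀ a, IsPMF (W a)) {t : ℝ} (ht0 : 0 ≤ t)
    (ht1 : t ≤ 1) : kernelInfo p (mixKernel p W t) ≤ (1 - t) * kernelInfo p W := by
  rw [kernelInfo, outMarg_mixKernel hp, kernelInfo, Finset.mul_sum]
  refine Finset.sum_le_sum fun a _ => ?_
  rw [Finset.mul_sum]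
  refine Finset.sum_le_sum fun b _ => ?_
  by_cases hb : outMarg p W b = 0
  · simp [hb]
  · have hq := (hp.outMarg hW).1 b
    have hconv := Real.convexOn_mul_log.2 (Set.mem_Ici.mpr (div_nonneg ((hW a).1 b) hq))
      (Set.mem_Ici.mpr zero_le_one) (sub_nonneg.mpr ht1) ht0 (by ring)
    simp only [smul_eq_mul, Real.log_one, mul_zero, add_zero, mul_one] at hconv
    have hr : mixKernel p W t a b / outMarg p W b = (1 - t) * (W a b / outMarg p W b) + t := by
      unfold mixKernel
      field_simp
    have hm : mixKernel p W t a b = outMarg p W b * ((1 - t) * (W a b / outMarg p W b) + t) := by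
      rw [← hr]
      field_simp
    have hw : W a b = outMarg p W b * (W a b / outMarg p W b) := by field_simp
    rw [hr, hm]
    calc _ = p a * outMarg p W b * (((1 - t) * (W a b / outMarg p W b) + t) *
          Real.log ((1 - t) * (W a b / outMarg p W b) + t)) := by ring
      _ ≤ p a * outMarg p W b * ((1 - t) *
          (W a b / outMarg p W b * Real.log (W a b / outMarg p W b))) :=
        mul_le_mul_of_nonneg_left hconv (mul_nonneg (hp.1 a) hq)
      _ = (1 - t) * (p a * (outMarg p W b * (W a b / outMarg p W b)) *
          Real.log (W a b / outMarg p W b)) := by ring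
      _ = _ := by rw [← hw]

theorem sum_iidPMF_mul_memoryless {ι : Type*} [Fintype ι] [DecidableEq ι] (p : α → ℝ)
    (W : α → β → ℝ) (φ : (ι → α) → (ι → β) → ℝ) :
    ∑ x, ∑ y, iidPMF p x * memoryless W x y * φ x y =
      ∑ w : ι → α × β, iidPMF (fun ab : α × β => p ab.1 * W ab.1 ab.2) w *
        φ (fun i => (w i).1) fun i => (w i).2 := by
  rw [← Fintype.sum_prod_type' (f := fun x y => iidPMF p x * memoryless W x y * φ x y)]
  refine (Fintype.sum_equiv (Equiv.arrowProdEquivProdArrow ι (fun _ => α) fun _ => β) _ _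
    fun w => ?_).symm
  simp [iidPMF, memoryless, Finset.prod_mul_distrib, Equiv.arrowProdEquivProdArrow]

theorem memoryless_eq_exp_mul {ι : Type*} [Fintype ι] [DecidableEq ι] (hp : IsPMF p)
    (hW : ∀ a, IsPMF (W a)) {w : ι → α × β}
    (hw : iidPMF (fun ab : α × β => p ab.1 * W ab.1 ab.2) w ≠ 0) :
    0 < outMarg (iidPMF p) (memoryless W) (fun i => (w i).2) ∧
    memoryless W (fun i => (w i).1) (fun i => (w i).2) =
      Real.exp (∑ i, Real.log (W (w i).1 (w i).2 / outMarg p W (w i).2)) *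
        outMarg (iidPMF p) (memoryless W) (fun i => (w i).2) := by
  have hpos : ∀ i, 0 < W (w i).1 (w i).2 ∧ 0 < outMarg p W (w i).2 := by
    intro i
    have hi : p (w i).1 * W (w i).1 (w i).2 ≠ 0 := Finset.prod_ne_zero_iff.mp hw i
      (Finset.mem_univ i)
    refine ⟨((hW _).1 _).lt_of_ne' (right_ne_zero_of_mul hi), ?_⟩
    exact lt_of_lt_of_le ((mul_nonneg (hp.1 _) ((hW _).1 _)).lt_of_ne' hi)
      (mul_le_outMarg hp hW _ _)
  rw [outMarg_memoryless]
  refine ⟨Finset.prod_pos fun i _ => (hpos i).2, ?_⟩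
  rw [memoryless, iidPMF, Real.exp_sum, ← Finset.prod_mul_distrib]
  refine Finset.prod_congr rfl fun i _ => ?_
  rw [Real.exp_log (div_pos (hpos i).1 (hpos i).2), div_mul_cancel₀ _ (hpos i).2.ne']

open Classical in
theorem tendsto_of_imp_deviation (hp : IsPMF p) (hW : ∀ a, IsPMF (W a)) {δ : ℝ} (hδ : 0 < δ)
    (E : ∀ n : ℕ, (Fin n → α) → (Fin n → β) → Prop)
    (hE : ∀ (n : ℕ) (w : Fin n → α × β),
      iidPMF (fun ab : α × β => p ab.1 * W ab.1 ab.2) w ≠ 0 →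
      E n (fun i => (w i).1) (fun i => (w i).2) →
      n * δ ≤ |∑ i, Real.log (W (w i).1 (w i).2 / outMarg p W (w i).2) - n * kernelInfo p W|) :
    Filter.Tendsto (fun n : ℕ => ∑ x : Fin n → α, ∑ y : Fin n → β,
      iidPMF p x * memoryless W x y * (if E n x y then 1 else 0)) Filter.atTop (nhds 0) := by
  have hj := hp.joint hW
  have hlim := tendsto_iidPMF_deviation hj
    (fun ab => Real.log (W ab.1 ab.2 / outMarg p W ab.2)) hδ
  have hmean : ∑ ab : α × β, p ab.1 * W ab.1 ab.2 *
      Real.log (W ab.1 ab.2 / outMarg p W ab.2) = kernelInfo p W := by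
    rw [Fintype.sum_prod_type]
    rfl
  rw [hmean] at hlim
  simp_rw [sum_iidPMF_mul_memoryless]
  refine squeeze_zero (fun n => Finset.sum_nonneg fun w _ =>
    mul_nonneg (hj.iid.1 w) (by split_ifs <;> norm_num)) (fun n => ?_) hlim
  refine Finset.sum_le_sum fun w _ => ?_
  by_cases hw : iidPMF (fun ab : α × β => p ab.1 * W ab.1 ab.2) w = 0
  · simp [hw]
  · refine mul_le_mul_of_nonneg_left ?_ (hj.iid.1 w)
    by_cases h : E n (fun i => (w i).1) (fun i => (w i).2)
    · rw [if_pos h, if_pos (hE n w hw h)]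
    · rw [if_neg h]
      split_ifs <;> norm_num

open Classical in
theorem tendsto_memoryless_large (hp : IsPMF p) (hW : ∀ a, IsPMF (W a)) {δ : ℝ} (hδ : 0 < δ) :
    Filter.Tendsto (fun n : ℕ => ∑ x : Fin n → α, ∑ y : Fin n → β,
      iidPMF p x * memoryless W x y *
        (if Real.exp (n * (kernelInfo p W + δ)) * outMarg (iidPMF p) (memoryless W) y <
          memoryless W x y then 1 else 0)) Filter.atTop (nhds 0) := by
  refine tendsto_of_imp_deviation hp hW hδ (fun n x y =>
    Real.exp (n * (kernelInfo p W + δ)) * outMarg (iidPMF p) (memoryless W) y <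
      memoryless W x y) fun n w hw h => ?_
  obtain ⟨hq, he⟩ := memoryless_eq_exp_mul hp hW hw
  simp only [he] at h
  have := Real.exp_lt_exp.mp (lt_of_mul_lt_mul_right h hq.le)
  exact le_trans (by linarith) (le_abs_self _)

open Classical in
theorem tendsto_memoryless_small (hp : IsPMF p) (hW : ∀ a, IsPMF (W a)) {δ : ℝ} (hδ : 0 < δ) :
    Filter.Tendsto (fun n : ℕ => ∑ x : Fin n → α, ∑ y : Fin n → β,
      iidPMF p x * memoryless W x y *
        (if memoryless W x y ≤
          Real.exp (n * (kernelInfo p W - δ)) * outMarg (iidPMF p) (memoryless W) y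
          then 1 else 0)) Filter.atTop (nhds 0) := by
  refine tendsto_of_imp_deviation hp hW hδ (fun n x y =>
    memoryless W x y ≤
      Real.exp (n * (kernelInfo p W - δ)) * outMarg (iidPMF p) (memoryless W) y) fun n w hw h => ?_
  obtain ⟨hq, he⟩ := memoryless_eq_exp_mul hp hW hw
  simp only [he] at h
  have := Real.exp_le_exp.mp (le_of_mul_le_mul_right h hq)
  exact le_trans (by linarith) (neg_le_abs _)

theorem sum_margProb_prodMk {Ω : Type*} [Fintype Ω] (P : Ω → ℝ) (f : Ω → α) (g : Ω → β) :
    (∀ a, margProb P f a = ∑ b, margProb P (fun ω => (f ω, g ω)) (a, b)) ∧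
    ∀ b, margProb P g b = ∑ a, margProb P (fun ω => (f ω, g ω)) (a, b) := by
  classical
  simp only [margProb, prob, Set.indicator_apply, Set.mem_ofPred_eq, Prod.mk.injEq]
  refine ⟨fun a => ?_, fun b => ?_⟩ <;> rw [Finset.sum_comm] <;>
    refine Finset.sum_congr rfl fun ω _ => ?_
  · by_cases h : f ω = a <;> simp [h]
  · by_cases h : g ω = b <;> simp [h]

theorem mutInfo_eq_kernelInfo {Ω : Type*} [Fintype Ω] {P : Ω → ℝ} {f : Ω → α} {g : Ω → β}
    (hW : ∀ a, IsPMF (W a))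
    (h : ∀ a b, margProb P (fun ω => (f ω, g ω)) (a, b) = p a * W a b) :
    mutInfo P f g = kernelInfo p W / Real.log 2 := by
  obtain ⟨hf, hg⟩ := sum_margProb_prodMk P f g
  have hf' : ∀ a, margProb P f a = p a := fun a => by
    rw [hf]; simp only [h, ← Finset.mul_sum, (hW a).2, mul_one]
  have hg' : ∀ b, margProb P g b = outMarg p W b := fun b => by
    rw [hg]; simp only [h]; rfl
  unfold mutInfo kernelInfo
  rw [Finset.sum_div]
  refine Finset.sum_congr rfl fun a _ => ?_
  rw [Finset.sum_div]
  refine Finset.sum_congr rfl fun b _ => ?_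
  rw [h, hf', hg', Real.logb, mul_div_assoc (p a * W a b)]
  by_cases ha : p a = 0
  · simp [ha]
  · rw [mul_div_mul_left _ _ ha]

end KernelInfo

/-! ### Achievability -/

open Classical in
/-- Indicator that the empirical distribution of the four sequences is more than `ε` away
from `P`. -/
def atypicality {S X Y Z : Type*} [Fintype S] [Fintype X] [Fintype Y] [Fintype Z] {n : ℕ}
    (ε : ℝ) (P : S × X × Y × Z → ℝ) (s : Fin n → S) (x : Fin n → X) (y : Fin n → Y)
    (z : Fin n → Z) : ℝ :=
  if ε < tvDist (empDist fun i => (s i, x i, y i, z i)) P then 1 else 0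

section Achievability

variable {S X Y Z : Type*} [Fintype S] [Fintype X] [Fintype Y] [Fintype Z]

theorem atypicality_nonneg {n : ℕ} (ε : ℝ) (P : S × X × Y × Z → ℝ) (s : Fin n → S)
    (x : Fin n → X) (y : Fin n → Y) (z : Fin n → Z) : 0 ≤ atypicality ε P s x y z := by
  unfold atypicality
  split_ifs <;> norm_num

theorem atypicality_le_one {n : ℕ} (ε : ℝ) (P : S × X × Y × Z → ℝ) (s : Fin n → S)
    (x : Fin n → X) (y : Fin n → Y) (z : Fin n → Z) : atypicality ε P s x y z ≤ 1 := by
  unfold atypicality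
  split_ifs <;> norm_num

/-- The joint distribution of a source with test channel `V` and an independent channel `W`. -/
def separatePMF (pS : S → ℝ) (V : S → Z → ℝ) (pX : X → ℝ) (W : X → Y → ℝ) (ω : S × X × Y × Z) :
    ℝ :=
  pS ω.1 * V ω.1 ω.2.2.2 * pX ω.2.1 * W ω.2.1 ω.2.2.1

variable {pS : S → ℝ} {V : S → Z → ℝ} {pX : X → ℝ} {W : X → Y → ℝ}

theorem sum_separatePMF (φ : S × X × Y × Z → ℝ) :
    ∑ ω, separatePMF pS V pX W ω * φ ω =
      ∑ s, ∑ z, ∑ x, ∑ y, pS s * V s z * (pX x * W x y) * φ (s, x, y, z) := by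
  simp only [Fintype.sum_prod_type, separatePMF]
  refine Finset.sum_congr rfl fun s _ => ?_
  rw [Finset.sum_comm (s := (Finset.univ : Finset Z))]
  refine Finset.sum_congr rfl fun x _ => ?_
  rw [Finset.sum_comm]
  refine Finset.sum_congr rfl fun z _ => Finset.sum_congr rfl fun y _ => ?_
  ring

theorem isPMF_separatePMF (hS : IsPMF pS) (hV : ∀ s, IsPMF (V s)) (hX : IsPMF pX)
    (hW : ∀ x, IsPMF (W x)) : IsPMF (separatePMF pS V pX W) := by
  refine ⟨fun ω => mul_nonneg (mul_nonneg (mul_nonneg (hS.1 _) ((hV _).1 _)) (hX.1 _))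
    ((hW _).1 _), ?_⟩
  have := sum_separatePMF (pS := pS) (V := V) (pX := pX) (W := W) fun _ => 1
  simp only [mul_one] at this
  simp [this, ← Finset.mul_sum, (hW _).2, hX.2, (hV _).2, hS.2]

theorem sum_iidPMF_separatePMF (n : ℕ) (φ : (Fin n → S) → (Fin n → X) → (Fin n → Y) →
      (Fin n → Z) → ℝ) :
    ∑ s : Fin n → S, ∑ z : Fin n → Z, ∑ x : Fin n → X, ∑ y : Fin n → Y,
      iidPMF pS s * memoryless V s z * (iidPMF pX x * memoryless W x y) * φ s x y z =
    ∑ w, iidPMF (separatePMF pS V pX W) w * φ (fun i => (w i).1) (fun i => (w i).2.1)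
      (fun i => (w i).2.2.1) (fun i => (w i).2.2.2) := by
  rw [← sum_separatePMF (S := Fin n → S) (X := Fin n → X) (Y := Fin n → Y) (Z := Fin n → Z)
    (φ := fun ω => φ ω.1 ω.2.1 ω.2.2.1 ω.2.2.2)]
  let e : (Fin n → S × X × Y × Z) ≃ (Fin n → S) × (Fin n → X) × (Fin n → Y) × (Fin n → Z) :=
    { toFun := fun w => (fun i => (w i).1, fun i => (w i).2.1, fun i => (w i).2.2.1,
        fun i => (w i).2.2.2)
      invFun := fun ω i => (ω.1 i, ω.2.1 i, ω.2.2.1 i, ω.2.2.2 i) }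
  refine (Fintype.sum_equiv e _ _ fun w => ?_).symm
  simp [e, iidPMF, memoryless, separatePMF, Finset.prod_mul_distrib]

theorem tendsto_sum_iid_atypicality (hS : IsPMF pS) (hV : ∀ s, IsPMF (V s)) (hX : IsPMF pX)
    (hW : ∀ x, IsPMF (W x)) {ε : ℝ} (hε : 0 < ε) :
    Filter.Tendsto (fun n : ℕ =>
      ∑ s : Fin n → S, ∑ z : Fin n → Z, ∑ x : Fin n → X, ∑ y : Fin n → Y,
        iidPMF pS s * memoryless V s z * (iidPMF pX x * memoryless W x y) *
          atypicality ε (separatePMF pS V pX W) s x y z) Filter.atTop (nhds 0) := by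
  simp_rw [sum_iidPMF_separatePMF]
  exact tendsto_iidPMF_tvDist_empDist (isPMF_separatePMF hS hV hX hW) hε

theorem achievable_of_forall_exists {PS : S → ℝ} {PYX : X → Y → ℝ} {P : S × X × Y × Z → ℝ}
    (h : ∀ ε : ℝ, 0 < ε → ∃ n : ℕ, 0 < n ∧ ∃ (f : (Fin n → S) → Fin n → X)
      (g : (Fin n → Y) → Fin n → Z), ∑ s, ∑ y, iidPMF PS s * memoryless PYX (f s) y *
        atypicality ε P s (f s) y (g y) < ε) :
    Achievable PS PYX EncoderClass.noncausal P := by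
  classical
  intro ε hε
  obtain ⟨n, hn, f, g, hfg⟩ := h ε hε
  refine ⟨n, hn, fun i s => f s i, fun i y => g y i, trivial, lt_of_eq_of_lt ?_ hfg⟩
  rw [prob, Fintype.sum_prod_type]
  refine Finset.sum_congr rfl fun s _ => Finset.sum_congr rfl fun y _ => ?_
  simp [Set.indicator_apply, atypicality, inducedP, iidPMF, memoryless]

theorem achievable_of_kernelInfo_lt (hS : IsPMF pS) (hV : ∀ s, IsPMF (V s)) (hX : IsPMF pX)
    (hW : ∀ x, IsPMF (W x)) (h : kernelInfo pS V < kernelInfo pX W) :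
    Achievable pS W EncoderClass.noncausal (separatePMF pS V pX W) := by
  classical
  refine achievable_of_forall_exists fun ε hε => ?_
  set δ := (kernelInfo pX W - kernelInfo pS V) / 4 with hδ
  have hδ0 : 0 < δ := by rw [hδ]; linarith
  have hexp : Filter.Tendsto (fun n : ℕ => Real.exp (n * δ)) Filter.atTop Filter.atTop :=
    Real.tendsto_exp_atTop.comp (tendsto_natCast_atTop_atTop.atTop_mul_const hδ0)
  have hlim := (((((tendsto_const_nhds (x := ε / 2)).add
    ((tendsto_sum_iid_atypicality hS hV hX hW hε).div_const (ε / 2))).add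
    (tendsto_memoryless_large hS hV hδ0)).add
    (Real.tendsto_exp_neg_atTop_nhds_zero.comp hexp)).add
    (tendsto_memoryless_small hX hW hδ0)).add (tendsto_inv_atTop_zero.comp hexp)
  simp only [zero_div, add_zero] at hlim
  obtain ⟨n, hn, hn0⟩ := ((hlim.eventually_lt_const (half_lt_self hε)).and
    (Filter.eventually_gt_atTop 0)).exists
  set r := Real.exp (n * (kernelInfo pS V + 2 * δ)) with hr
  have hr0 : 0 < r := Real.exp_pos _
  set M := ⌈r⌉₊ with hM
  have hM1 : r ≤ M := Nat.le_ceil r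
  have hM2 : (M : ℝ) - 1 ≤ r := by linarith [Nat.ceil_lt_add_one hr0.le]
  obtain ⟨f, g, hfg⟩ := exists_separation_code (hS.iid (ι := Fin n)) (IsPMF.memoryless hV)
    (hX.iid (ι := Fin n)) (IsPMF.memoryless hW)
    (atypicality_nonneg ε (separatePMF pS V pX W)) (atypicality_le_one ε _)
    (Nat.ceil_pos.mpr hr0) (half_pos hε)
    (Real.exp_pos (n * (kernelInfo pS V + δ))) (Real.exp_pos (n * (kernelInfo pX W - δ)))
  refine ⟨n, hn0, f, g, lt_of_le_of_lt hfg (lt_of_le_of_lt ?_ hn)⟩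
  have h1 : Real.exp (-(M / Real.exp (n * (kernelInfo pS V + δ)))) ≤
      Real.exp (-Real.exp (n * δ)) := by
    rw [Real.exp_le_exp, neg_le_neg_iff, le_div_iff₀ (Real.exp_pos _), ← Real.exp_add]
    refine le_trans (le_of_eq ?_) hM1
    rw [hr]
    congr 1
    ring
  have h2 : ((M : ℝ) - 1) / Real.exp (n * (kernelInfo pX W - δ)) ≤ (Real.exp (n * δ))⁻¹ := by
    rw [div_le_iff₀ (Real.exp_pos _), ← Real.exp_neg, ← Real.exp_add]
    refine hM2.trans (le_of_eq ?_)
    rw [hr]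
    congr 1
    rw [hδ]
    ring
  simp only [Function.comp_apply]
  gcongr

theorem achievable_of_kernelInfo_eq_zero (hS : IsPMF pS) (hV : ∀ s, IsPMF (V s)) (hX : IsPMF pX)
    (hW : ∀ x, IsPMF (W x)) (h : kernelInfo pS V = 0) :
    Achievable pS W EncoderClass.noncausal (separatePMF pS V pX W) := by
  refine achievable_of_forall_exists fun ε hε => ?_
  obtain ⟨n, hn, hn0⟩ := (((tendsto_sum_iid_atypicality hS hV hX hW hε).eventually_lt_const
    hε).and (Filter.eventually_gt_atTop 0)).exists
  set c := atypicality (n := n) ε (separatePMF pS V pX W)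
  have hind : ∀ (s : Fin n → S) z, iidPMF pS s * memoryless V s z =
      iidPMF (outMarg pS V) z * iidPMF pS s := by
    intro s z
    simp only [iidPMF, memoryless, ← Finset.prod_mul_distrib]
    refine Finset.prod_congr rfl fun i _ => ?_
    rw [mul_eq_mul_outMarg_of_kernelInfo_eq_zero hS hV h, mul_comm]
  have havg : ∑ z : Fin n → Z, iidPMF (outMarg pS V) z * ∑ x : Fin n → X, iidPMF pX x *
      ∑ s, ∑ y, iidPMF pS s * memoryless W x y * c s x y z ≤
      ∑ s : Fin n → S, ∑ z : Fin n → Z, ∑ x : Fin n → X, ∑ y : Fin n → Y,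
        iidPMF pS s * memoryless V s z * (iidPMF pX x * memoryless W x y) * c s x y z := by
    refine le_of_eq ?_
    rw [Finset.sum_comm]
    simp_rw [hind]
    refine Finset.sum_congr rfl fun z _ => ?_
    rw [Finset.sum_comm, Finset.mul_sum]
    refine Finset.sum_congr rfl fun x _ => ?_
    simp_rw [Finset.mul_sum]
    refine Finset.sum_congr rfl fun s _ => Finset.sum_congr rfl fun y _ => ?_
    ring
  obtain ⟨z, hz⟩ := (hS.outMarg hV).iid.exists_le_of_sum_le havg
  obtain ⟨x, hx⟩ := hX.iid.exists_le_of_sum_le hz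
  exact ⟨n, hn0, fun _ => x, fun _ => z, lt_of_le_of_lt hx hn⟩

theorem tvDist_triangle {α : Type*} [Fintype α] (p q r : α → ℝ) :
    tvDist p r ≤ tvDist p q + tvDist q r := by
  unfold tvDist
  rw [← add_div, ← Finset.sum_add_distrib]
  gcongr
  exact abs_sub_le _ _ _

/-- Achievability is closed under total variation limits. -/
theorem Achievable.of_tvDist_le {PS : S → ℝ} {PYX : X → Y → ℝ} {κ : EncoderClass}
    {P : S × X × Y × Z → ℝ} (hPS : IsPMF PS) (hPYX : ∀ x, IsPMF (PYX x))
    (h : ∀ ε : ℝ, 0 < ε → ∃ Q, tvDist Q P ≤ ε ∧ Achievable PS PYX κ Q) :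
    Achievable PS PYX κ P := by
  classical
  intro ε hε
  obtain ⟨Q, hQ, hach⟩ := h (ε / 2) (half_pos hε)
  obtain ⟨n, hn, f, g, hf, hfg⟩ := hach (ε / 2) (half_pos hε)
  refine ⟨n, hn, f, g, hf, lt_of_le_of_lt ?_ (hfg.trans (half_lt_self hε))⟩
  refine Finset.sum_le_sum fun sy _ => Set.indicator_le_indicator_of_subset (fun sy hsy => ?_)
    (fun sy => mul_nonneg (Finset.prod_nonneg fun i _ => hPS.1 _)
      (Finset.prod_nonneg fun i _ => (hPYX _).1 _)) sy
  simp only [Set.mem_ofPred_eq] at hsy ⊢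
  linarith [tvDist_triangle (empDist fun i => (sy.1 i, f i sy.1, sy.2 i, g i sy.2)) Q P]

theorem tvDist_separatePMF_mixKernel_le (hS : IsPMF pS) (hV : ∀ s, IsPMF (V s)) (hX : IsPMF pX)
    (hW : ∀ x, IsPMF (W x)) {t : ℝ} (ht : 0 ≤ t) :
    tvDist (separatePMF pS (mixKernel pS V t) pX W) (separatePMF pS V pX W) ≤ t := by
  have hq := isPMF_separatePMF hS (fun _ => hS.outMarg hV) hX hW
  have hv := isPMF_separatePMF hS hV hX hW
  have : ∀ ω, |separatePMF pS (mixKernel pS V t) pX W ω - separatePMF pS V pX W ω| ≤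
      t * separatePMF pS (fun _ => outMarg pS V) pX W ω + t * separatePMF pS V pX W ω := by
    intro ω
    have he : separatePMF pS (mixKernel pS V t) pX W ω - separatePMF pS V pX W ω =
        t * separatePMF pS (fun _ => outMarg pS V) pX W ω - t * separatePMF pS V pX W ω := by
      simp only [separatePMF, mixKernel]
      ring
    have h1 := mul_nonneg ht (hq.1 ω)
    have h2 := mul_nonneg ht (hv.1 ω)
    rw [he, abs_le]
    constructor <;> linarith
  have hsum := Finset.sum_le_sum fun ω (_ : ω ∈ Finset.univ) => this ω
  rw [Finset.sum_add_distrib, ← Finset.mul_sum, ← Finset.mul_sum, hq.2, hv.2] at hsum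
  unfold tvDist
  linarith

theorem achievable_separatePMF (hS : IsPMF pS) (hV : ∀ s, IsPMF (V s)) (hX : IsPMF pX)
    (hW : ∀ x, IsPMF (W x)) (h : kernelInfo pS V ≤ kernelInfo pX W) :
    Achievable pS W EncoderClass.noncausal (separatePMF pS V pX W) := by
  rcases (kernelInfo_nonneg hS hV).eq_or_lt with h0 | h0
  · exact achievable_of_kernelInfo_eq_zero hS hV hX hW h0.symm
  refine Achievable.of_tvDist_le hS hW fun ε hε => ?_
  have ht0 : 0 < min ε 1 := lt_min hε one_pos
  refine ⟨_, (tvDist_separatePMF_mixKernel_le hS hV hX hW ht0.le).trans (min_le_left _ _),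
    achievable_of_kernelInfo_lt hS (hS.mixKernel hV ht0.le (min_le_right _ _)) hX hW ?_⟩
  have := kernelInfo_mixKernel_le hS hV ht0.le (min_le_right ε 1)
  nlinarith [mul_pos ht0 h0]

theorem margProb_separatePMF_source (hX : IsPMF pX) (hW : ∀ x, IsPMF (W x)) (s : S) (z : Z) :
    margProb (separatePMF pS V pX W) (fun ω => (ω.1, ω.2.2.2)) (s, z) = pS s * V s z := by
  classical
  have := sum_separatePMF (pS := pS) (V := V) (pX := pX) (W := W)
    fun ω => if ω.1 = s then (if ω.2.2.2 = z then 1 else 0) else 0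
  simp only [mul_ite, mul_one, mul_zero, ← Finset.mul_sum, Finset.sum_ite_irrel,
    Finset.sum_const_zero, Finset.sum_ite_eq', Finset.mem_univ, if_true] at this
  simp only [margProb, prob, Set.indicator_apply, Set.mem_ofPred_eq, Prod.mk.injEq, ite_and, this]
  simp [(hW _).2, hX.2]

theorem margProb_separatePMF_channel (hS : IsPMF pS) (hV : ∀ s, IsPMF (V s)) (x : X) (y : Y) :
    margProb (separatePMF pS V pX W) (fun ω => (ω.2.1, ω.2.2.1)) (x, y) = pX x * W x y := by
  classical
  have := sum_separatePMF (pS := pS) (V := V) (pX := pX) (W := W)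
    fun ω => if ω.2.1 = x then (if ω.2.2.1 = y then 1 else 0) else 0
  simp only [mul_ite, mul_one, mul_zero, Finset.sum_ite_irrel, Finset.sum_const_zero,
    Finset.sum_ite_eq', Finset.mem_univ, if_true, ← Finset.sum_mul, hS.sum_kernel hV,
    one_mul] at this
  simp only [margProb, prob, Set.indicator_apply, Set.mem_ofPred_eq, Prod.mk.injEq, ite_and, this]

end Achievability

/-- **Separation inner bound.**
If the pmf `P` on `S × X × Y × Ŝ` factors as `P_S · P_{Ŝ|S} · P_X · P_{Y|X}`
(so `(S,Ŝ)` is independent of `(X,Y)`) and `I(S;Ŝ) ≤ I(X;Y)`, then `P` is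
achievable with a noncausal encoder. -/
theorem separation_inner_bound
    {S X Y Z : Type} [Fintype S] [Fintype X] [Fintype Y] [Fintype Z]
    (PS : S → ℝ) (PYX : X → Y → ℝ)
    (hPS : IsPMF PS) (hPYX : ∀ x, IsPMF (PYX x))
    (PZgS : S → Z → ℝ) (PX : X → ℝ)
    (hPZgS : ∀ s, IsPMF (PZgS s)) (hPX : IsPMF PX)
    (P : S × X × Y × Z → ℝ)
    (hP : ∀ s x y z, P (s, x, y, z) = PS s * PZgS s z * PX x * PYX x y)
    (hMI : mutInfo P (fun ω => ω.1) (fun ω => ω.2.2.2)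
         ≤ mutInfo P (fun ω => ω.2.1) (fun ω => ω.2.2.1)) :
    Achievable PS PYX EncoderClass.noncausal P := by
  obtain rfl : P = separatePMF PS PZgS PX PYX := funext fun ω => hP _ _ _ _
  rw [mutInfo_eq_kernelInfo hPZgS (margProb_separatePMF_source hPX hPYX),
    mutInfo_eq_kernelInfo hPYX (margProb_separatePMF_channel hPS hPZgS),
    div_le_div_iff_of_pos_right (Real.log_pos one_lt_two)] at hMI
  exact achievable_separatePMF hPS hPZgS hPX hPYX hMI

end
end

section
/- Key binary-entropy inequality for the example: let h(t) = −t·log₂ t − (1−t)·log₂(1−t) (with h(0) = h(1) = 0) and a⋆b = a(1−b) + b(1−a). If 0 ≤ ε ≤ d < 1/2 and d ≤ p ≤ 1/2, and q = (p−d)/(1−2d), then h(p) − h(d) ≤ h(q⋆ε) − h(ε). -/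
noncomputable section

/-- The binary entropy function (base-2 logarithms); since `Real.logb 2 0 = 0`,
this definition automatically gives `binEnt 0 = binEnt 1 = 0`. -/
def binEnt (t : ℝ) : ℝ := -(t * Real.logb 2 t) - (1 - t) * Real.logb 2 (1 - t)

/-- Binary convolution of crossover probabilities: `a ⋆ b = a(1−b) + b(1−a)`. -/
def bconv (a b : ℝ) : ℝ := a * (1 - b) + b * (1 - a)

theorem binEnt_eq_binEntropy_div_log_two (t : ℝ) : binEnt t = Real.binEntropy t / Real.log 2 := by
  simp only [binEnt, Real.binEntropy, Real.logb, Real.log_inv]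
  ring

/-- For `q ≤ 1/2`, the entropy increase caused by convolution with `q` is antitone on `[0, 1/2]`. -/
theorem antitoneOn_binEntropy_bconv_sub {q : ℝ} (hq0 : 0 ≤ q) (hq : q ≤ 1 / 2) :
    AntitoneOn (fun x => Real.binEntropy (bconv q x) - Real.binEntropy x) (Set.Icc 0 (1 / 2)) := by
  have hderiv : ∀ x ∈ interior (Set.Icc (0 : ℝ) (1 / 2)),
      HasDerivAt (fun x => Real.binEntropy (bconv q x) - Real.binEntropy x)
        ((Real.log (1 - bconv q x) - Real.log (bconv q x)) * (1 - 2 * q)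
          - (Real.log (1 - x) - Real.log x)) x ∧
      0 < x ∧ x < 1 / 2 ∧ x ≤ bconv q x ∧ bconv q x ≤ 1 / 2 := by
    intro x hx
    rw [interior_Icc] at hx
    obtain ⟨hx0, hx1⟩ := hx
    have hle : x ≤ bconv q x := by unfold bconv; nlinarith
    have hhalf : bconv q x ≤ 1 / 2 := by unfold bconv; nlinarith
    have hconv : HasDerivAt (bconv q) (1 - 2 * q) x := by
      have h := ((hasDerivAt_id x).const_sub 1 |>.const_mul q).add
        ((hasDerivAt_id x).mul_const (1 - q))
      exact h.congr_deriv (by ring)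
    refine ⟨?_, hx0, hx1, hle, hhalf⟩
    exact ((Real.hasDerivAt_binEntropy (by linarith) (by linarith)).comp x hconv).sub
      (Real.hasDerivAt_binEntropy (by linarith) (by linarith))
  refine antitoneOn_of_deriv_nonpos (convex_Icc _ _) ?_ ?_ ?_
  · unfold bconv
    fun_prop
  · exact fun x hx => (hderiv x hx).1.differentiableAt.differentiableWithinAt
  · intro x hx
    obtain ⟨h, hx0, hx1, hle, hhalf⟩ := hderiv x hx
    rw [h.deriv]
    have h1 : Real.log x ≤ Real.log (bconv q x) := Real.log_le_log hx0 hle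
    have h2 : Real.log (1 - bconv q x) ≤ Real.log (1 - x) :=
      Real.log_le_log (by linarith) (by linarith)
    have h3 : Real.log (bconv q x) ≤ Real.log (1 - bconv q x) :=
      Real.log_le_log (by linarith) (by linarith)
    nlinarith

/-- **Key binary-entropy inequality for the example.** If `0 ≤ e ≤ d < 1/2`,
`d ≤ p ≤ 1/2` and `q = (p−d)/(1−2d)`, then `h(p) − h(d) ≤ h(q ⋆ e) − h(e)`. -/
theorem binEnt_key_inequality
    (e d p q : ℝ)
    (he0 : 0 ≤ e) (hed : e ≤ d) (hd : d < 1 / 2) (hdp : d ≤ p) (hp : p ≤ 1 / 2)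
    (hq : q = (p - d) / (1 - 2 * d)) :
    binEnt p - binEnt d ≤ binEnt (bconv q e) - binEnt e := by
  have hpos : 0 < 1 - 2 * d := by linarith
  have hq0 : 0 ≤ q := hq ▸ div_nonneg (by linarith) hpos.le
  have hq1 : q ≤ 1 / 2 := by
    rw [hq, div_le_iff₀ hpos]
    linarith
  have hpq : bconv q d = p := by
    rw [eq_div_iff hpos.ne'] at hq
    unfold bconv
    linarith
  have key := antitoneOn_binEntropy_bconv_sub hq0 hq1 (Set.mem_Icc.2 ⟨he0, by linarith⟩)
    (Set.mem_Icc.2 ⟨by linarith, hd.le⟩) hed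
  simp only [hpq] at key
  simp only [binEnt_eq_binEntropy_div_log_two, ← sub_div]
  exact div_le_div_of_nonneg_right key (Real.log_nonneg one_le_two)

end
end

section
/- Csiszár sum identity: for any jointly distributed random variables S_1,…,S_n and Y_1,…,Y_n taking values in finite sets, Σ_{i=1}^n I(Y_{i+1}ⁿ; S_i | S^{i−1}) = Σ_{i=1}^n I(S^{i−1}; Y_i | Y_{i+1}ⁿ), where S^{i−1} = (S_1,…,S_{i−1}) and Y_{i+1}ⁿ = (Y_{i+1},…,Y_n), and the terms for empty index ranges are zero. -/
noncomputable section

/-- The law of `f` under `P` integrates test functions by pullback. -/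
lemma sum_margProb_mul {Ω D : Type*} [Fintype Ω] [Fintype D]
    (P : Ω → ℝ) (f : Ω → D) (F : D → ℝ) :
    ∑ a, margProb P f a * F a = ∑ ω, P ω * F (f ω) := by
  classical
  simp only [margProb, prob, Finset.sum_mul, Set.indicator_apply, Set.mem_ofPred_eq]
  rw [Finset.sum_comm]
  refine Finset.sum_congr rfl fun ω _ => ?_
  simp [ite_mul]

/-- The negative entropy (in bits) of the random variable `f` under `P`. -/
def negEntropy {Ω D : Type*} [Fintype Ω] (P : Ω → ℝ) (f : Ω → D) : ℝ :=
  ∑ ω, P ω * Real.logb 2 (margProb P f (f ω))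

/-- Entropy depends only on the partition into fibres. -/
lemma negEntropy_congr {Ω D E : Type*} [Fintype Ω] (P : Ω → ℝ) (f : Ω → D) (g : Ω → E)
    (h : ∀ ω ω', f ω = f ω' ↔ g ω = g ω') : negEntropy P f = negEntropy P g := by
  simp only [negEntropy, margProb, h]

lemma margProb_apply_pos {Ω D : Type*} [Fintype Ω] {P : Ω → ℝ} (hP : ∀ ω, 0 ≤ P ω)
    (f : Ω → D) {ω : Ω} (hω : 0 < P ω) : 0 < margProb P f (f ω) := by
  refine Finset.sum_pos' (fun x _ => Set.indicator_nonneg (fun y _ => hP y) x)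
    ⟨ω, Finset.mem_univ _, ?_⟩
  rwa [Set.indicator_of_mem (by simp)]

/-- Conditional mutual information as a combination of entropies. -/
lemma condMutInfo_eq_negEntropy {Ω A B C : Type*} [Fintype Ω] [Fintype A] [Fintype B]
    [Fintype C] {P : Ω → ℝ} (hP : ∀ ω, 0 ≤ P ω) (f : Ω → A) (g : Ω → B) (h : Ω → C) :
    condMutInfo P f g h =
      negEntropy P (fun ω => (f ω, g ω, h ω)) + negEntropy P h
        - negEntropy P (fun ω => (f ω, h ω)) - negEntropy P (fun ω => (g ω, h ω)) := by
  have key := sum_margProb_mul P (fun ω => (f ω, g ω, h ω)) (fun x =>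
    Real.logb 2 ((margProb P (fun ω => (f ω, g ω, h ω)) x * margProb P h x.2.2) /
      (margProb P (fun ω => (f ω, h ω)) (x.1, x.2.2) *
        margProb P (fun ω => (g ω, h ω)) (x.2.1, x.2.2))))
  simp only [Fintype.sum_prod_type] at key
  rw [condMutInfo, key]
  simp only [negEntropy, ← Finset.sum_add_distrib, ← Finset.sum_sub_distrib]
  refine Finset.sum_congr rfl fun ω _ => ?_
  rcases (hP ω).eq_or_lt with h0 | h0
  · simp [← h0]
  have h1 := (margProb_apply_pos hP (fun ω => (f ω, g ω, h ω)) h0).ne'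
  have h2 := (margProb_apply_pos hP h h0).ne'
  have h3 := (margProb_apply_pos hP (fun ω => (f ω, h ω)) h0).ne'
  have h4 := (margProb_apply_pos hP (fun ω => (g ω, h ω)) h0).ne'
  rw [Real.logb_div (mul_ne_zero h1 h2) (mul_ne_zero h3 h4), Real.logb_mul h1 h2,
    Real.logb_mul h3 h4]
  ring

/-- The pair consisting of the first-component entries with index below `k` and the
second-component entries with index at least `l`. -/
def prefixSuffix {A B : Type*} (n k l : ℕ) (ω : (Fin n → A) × (Fin n → B)) :
    ({j : Fin n // j.1 < k} → A) × ({j : Fin n // l ≤ j.1} → B) :=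
  (fun j => ω.1 j.1, fun j => ω.2 j.1)

lemma prefixSuffix_eq_iff {A B : Type*} {n k l : ℕ} {ω ω' : (Fin n → A) × (Fin n → B)} :
    prefixSuffix n k l ω = prefixSuffix n k l ω' ↔
      (∀ j : Fin n, j.1 < k → ω.1 j = ω'.1 j) ∧ (∀ j : Fin n, l ≤ j.1 → ω.2 j = ω'.2 j) := by
  simp [prefixSuffix, funext_iff]

lemma Fin.forall_lt_succ_iff {n : ℕ} (i : Fin n) (p : Fin n → Prop) :
    (∀ j : Fin n, j.1 < i.1 + 1 → p j) ↔ p i ∧ ∀ j : Fin n, j < i → p j := by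
  refine ⟨fun h => ⟨h i (by omega), fun j hj => h j (by omega)⟩, fun h j hj => ?_⟩
  rcases eq_or_ne j i with rfl | hne
  · exact h.1
  · exact h.2 j (by omega)

lemma Fin.forall_le_val_iff {n : ℕ} (i : Fin n) (p : Fin n → Prop) :
    (∀ j : Fin n, i.1 ≤ j.1 → p j) ↔ p i ∧ ∀ j : Fin n, i < j → p j := by
  refine ⟨fun h => ⟨h i le_rfl, fun j hj => h j (by omega)⟩, fun h j hj => ?_⟩
  rcases eq_or_ne j i with rfl | hne
  · exact h.1
  · exact h.2 j (by omega)

lemma Fin.forall_succ_le_val_iff {n : ℕ} (i : Fin n) (p : Fin n → Prop) :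
    (∀ j : Fin n, i.1 + 1 ≤ j.1 → p j) ↔ ∀ j : Fin n, i < j → p j := Iff.rfl

lemma Fin.forall_val_lt_val_iff {n : ℕ} (i : Fin n) (p : Fin n → Prop) :
    (∀ j : Fin n, j.1 < i.1 → p j) ↔ ∀ j : Fin n, j < i → p j := Iff.rfl

lemma Fin.forall_size_le_val {n : ℕ} (p : Fin n → Prop) :
    (∀ j : Fin n, n ≤ j.1 → p j) ↔ True :=
  iff_true_intro fun j hj => absurd j.2 (by omega)

/-- **Csiszár sum identity.** For jointly distributed finite random variables
`S₁,…,Sₙ` and `Y₁,…,Yₙ` (with joint pmf `P`),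
`∑ᵢ I(Y₍ᵢ₊₁₎ⁿ ; Sᵢ | Sⁱ⁻¹) = ∑ᵢ I(Sⁱ⁻¹ ; Yᵢ | Y₍ᵢ₊₁₎ⁿ)`,
where `Sⁱ⁻¹ = (S₁,…,Sᵢ₋₁)`, `Y₍ᵢ₊₁₎ⁿ = (Yᵢ₊₁,…,Yₙ)`. -/
theorem csiszar_sum_identity
    {A B : Type} [Fintype A] [Fintype B] (n : ℕ)
    (P : (Fin n → A) × (Fin n → B) → ℝ) (hP : IsPMF P) :
    (∑ i : Fin n,
      condMutInfo P (fun ω => fun j : {j : Fin n // i < j} => ω.2 j.1)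
        (fun ω => ω.1 i) (fun ω => fun j : {j : Fin n // j.1 < i} => ω.1 j.1))
    = ∑ i : Fin n,
      condMutInfo P (fun ω => fun j : {j : Fin n // j.1 < i} => ω.1 j.1)
        (fun ω => ω.2 i) (fun ω => fun j : {j : Fin n // i < j} => ω.2 j.1) := by
  let G : ℕ → ℕ → ℝ := fun k l => negEntropy P (prefixSuffix n k l)
  have hS : ∀ i : Fin n,
      condMutInfo P (fun ω => fun j : {j : Fin n // i < j} => ω.2 j.1)
        (fun ω => ω.1 i) (fun ω => fun j : {j : Fin n // j.1 < i} => ω.1 j.1)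
      = G (i + 1) (i + 1) + G i n - G i (i + 1) - G (i + 1) n := by
    intro i
    rw [condMutInfo_eq_negEntropy hP.1]
    congr 1; congr 1; congr 1
    all_goals
      refine negEntropy_congr _ _ _ fun ω ω' => ?_
      simp only [prefixSuffix_eq_iff, Fin.forall_lt_succ_iff, Fin.forall_succ_le_val_iff,
        Fin.forall_val_lt_val_iff, Fin.forall_size_le_val, Prod.mk.injEq, funext_iff,
        Subtype.forall]
      tauto
  have hY : ∀ i : Fin n,
      condMutInfo P (fun ω => fun j : {j : Fin n // j.1 < i} => ω.1 j.1)
        (fun ω => ω.2 i) (fun ω => fun j : {j : Fin n // i < j} => ω.2 j.1)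
      = G i i + G 0 (i + 1) - G i (i + 1) - G 0 i := by
    intro i
    rw [condMutInfo_eq_negEntropy hP.1]
    congr 1; congr 1; congr 1
    all_goals
      refine negEntropy_congr _ _ _ fun ω ω' => ?_
      simp only [prefixSuffix_eq_iff, Fin.forall_le_val_iff, Fin.forall_succ_le_val_iff,
        Fin.forall_val_lt_val_iff, Nat.not_lt_zero, Prod.mk.injEq, funext_iff,
        Subtype.forall] <;> tauto
  simp only [hS, hY]
  rw [Fin.sum_univ_eq_sum_range
      (fun i => G (i + 1) (i + 1) + G i n - G i (i + 1) - G (i + 1) n),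
    Fin.sum_univ_eq_sum_range (fun i => G i i + G 0 (i + 1) - G i (i + 1) - G 0 i),
    ← sub_eq_zero, ← Finset.sum_sub_distrib]
  have hdiag := Finset.sum_range_sub (fun i => G i i - G i n - G 0 i) n
  rw [Finset.sum_congr rfl fun i _ => show _ =
    (G (i + 1) (i + 1) - G (i + 1) n - G 0 (i + 1)) - (G i i - G i n - G 0 i) by ring, hdiag]
  ring

end
end

section
/- Converse Markov-chain lemma for strictly causal encoding: let S_1,…,S_n be i.i.d. with pmf P_S on a finite set 𝒮, let X_i = f_i(S^{i−1}), let the channel be memoryless so that given Xⁿ the outputs Y_1,…,Y_n are conditionally independent with Y_i ∼ P_{Y|X}(·|X_i), and let Ŝ_i = g_i(Yⁿ) for decoder functions g_i : 𝒴ⁿ → Ŝ. Let Q be uniform on {1,…,n} and independent of (Sⁿ, Xⁿ, Yⁿ, Ŝⁿ), and define V = (S^{Q−1}, Y_{Q+1}ⁿ, Q). Then: (i) S_Q is independent of X_Q; (ii) (S_Q, V) — X_Q — Y_Q forms a Markov chain, i.e., Y_Q is conditionally independent of (S_Q, V) given X_Q; (iii) (S_Q, X_Q) — (Y_Q, V)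 — Ŝ_Q forms a Markov chain, i.e., Ŝ_Q is conditionally independent of (S_Q, X_Q) given (Y_Q, V). -/
noncomputable section

open Classical in
theorem prob_triple_eq_sum {A B C : Type*} [Fintype A] [Fintype B] [Fintype C]
    (P : A × B × C → ℝ) (E : Set (A × B × C)) :
    prob P E = ∑ a, ∑ b, ∑ c, if (a, b, c) ∈ E then P (a, b, c) else 0 := by
  simp only [prob, Set.indicator_apply, Fintype.sum_prod_type]

theorem IsPMF.sum_prod_eq_one {ι α : Type*} [Fintype ι] [DecidableEq ι] [Fintype α]
    {p : ι → α → ℝ} (hp : ∀ i, IsPMF (p i)) : ∑ s : ι → α, ∏ i, p i (s i) = 1 := by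
  rw [← Fintype.prod_sum]
  exact Finset.prod_eq_one fun i _ => (hp i).2

/-- Exchanging the `q`-th coordinate of a tuple with a separate element, as an equivalence. -/
def swapCoord {ι : Type*} [DecidableEq ι] (α : Type*) (q : ι) :
    Equiv.Perm ((ι → α) × α) :=
  Function.Involutive.toPerm (fun t => (Function.update t.1 q t.2, t.1 q))
    fun t => by simp

theorem swapCoord_apply {ι : Type*} [DecidableEq ι] {α : Type*} (q : ι) (t : (ι → α) × α) :
    swapCoord α q t = (Function.update t.1 q t.2, t.1 q) :=
  rfl

open Classical in
/-- Under a product pmf, a coordinate is independent of an event not involving it. -/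
theorem IsPMF.sum_prod_ite_eval_and {ι α : Type*} [Fintype ι] [DecidableEq ι] [Fintype α]
    {p : ι → α → ℝ} (q : ι) (hp : IsPMF (p q)) (a₀ : α) (A : (ι → α) → Prop)
    (hA : ∀ s a, A (Function.update s q a) ↔ A s) :
    ∑ s : ι → α, (if s q = a₀ ∧ A s then ∏ i, p i (s i) else 0)
      = p q a₀ * ∑ s : ι → α, if A s then ∏ i, p i (s i) else 0 := by
  have hsplit : ∀ s : ι → α,
      ∏ i, p i (s i) = p q (s q) * ∏ i ∈ Finset.univ.erase q, p i (s i) := fun s =>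
    (Finset.mul_prod_erase _ _ (Finset.mem_univ q)).symm
  have hrest : ∀ (s : ι → α) (a : α),
      ∏ i ∈ Finset.univ.erase q, p i (Function.update s q a i)
        = ∏ i ∈ Finset.univ.erase q, p i (s i) := fun s a =>
    Finset.prod_congr rfl fun i hi => by
      rw [Function.update_of_ne (Finset.ne_of_mem_erase hi)]
  calc ∑ s : ι → α, (if s q = a₀ ∧ A s then ∏ i, p i (s i) else 0)
      = ∑ s : ι → α, ∑ a, p q a * (if s q = a₀ ∧ A s then ∏ i, p i (s i) else 0) := by
        refine Finset.sum_congr rfl fun s _ => ?_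
        rw [← Finset.sum_mul, hp.2, one_mul]
    _ = ∑ t : (ι → α) × α,
          p q t.2 * (if t.1 q = a₀ ∧ A t.1 then ∏ i, p i (t.1 i) else 0) := by
        rw [Fintype.sum_prod_type]
    _ = ∑ t : (ι → α) × α,
          p q (t.1 q) * (if t.2 = a₀ ∧ A t.1 then
            p q t.2 * ∏ i ∈ Finset.univ.erase q, p i (t.1 i) else 0) := by
        rw [← Equiv.sum_comp (swapCoord α q)]
        refine Finset.sum_congr rfl fun t _ => ?_
        simp only [swapCoord_apply, hA, hsplit, hrest,
          Function.update_self]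
    _ = ∑ s : ι → α, ∑ a, if a = a₀ then
          p q a * (if A s then ∏ i, p i (s i) else 0) else 0 := by
        rw [Fintype.sum_prod_type]
        refine Finset.sum_congr rfl fun s _ => Finset.sum_congr rfl fun a _ => ?_
        rw [hsplit]
        by_cases ha : a = a₀ <;> by_cases hs : A s <;> simp [ha, hs]
        ring
    _ = _ := by simp [Finset.mul_sum]

section StrictlyCausal

variable {S X Y : Type} {n : ℕ}

/-- The joint pmf of `(Q, Sⁿ, Yⁿ)` for strictly causal encoding over a memoryless channel. -/
def strictlyCausalPMF (PS : S → ℝ) (PYX : X → Y → ℝ)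
    (f : (i : Fin n) → ({j : Fin n // j < i} → S) → X)
    (ω : Fin n × (Fin n → S) × (Fin n → Y)) : ℝ :=
  (1 / (n : ℝ)) * (∏ i, PS (ω.2.1 i)) * ∏ i, PYX (f i (fun j => ω.2.1 j.1)) (ω.2.2 i)

variable [Fintype S] [Fintype Y]
  {PS : S → ℝ} {PYX : X → Y → ℝ} {f : (i : Fin n) → ({j : Fin n // j < i} → S) → X}

open Classical in
theorem prob_strictlyCausalPMF_source (hPYX : ∀ x, IsPMF (PYX x))
    (A : Fin n → (Fin n → S) → Prop) :
    prob (strictlyCausalPMF PS PYX f) {ω | A ω.1 ω.2.1}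
      = ∑ q, (1 / (n : ℝ)) * ∑ s : Fin n → S, if A q s then ∏ i, PS (s i) else 0 := by
  rw [prob_triple_eq_sum]
  refine Finset.sum_congr rfl fun q _ => ?_
  rw [Finset.mul_sum]
  refine Finset.sum_congr rfl fun s _ => ?_
  by_cases h : A q s
  · simp only [Set.mem_ofPred_eq, h, if_true, strictlyCausalPMF]
    rw [← Finset.mul_sum,
      IsPMF.sum_prod_eq_one (p := fun i => PYX (f i fun j => s j.1)) fun i => hPYX _, mul_one]
  · simp [h]

theorem prob_strictlyCausalPMF_source_eval_and (hPS : IsPMF PS) (hPYX : ∀ x, IsPMF (PYX x))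
    (s₀ : S) (A : Fin n → (Fin n → S) → Prop)
    (hA : ∀ q s a, A q (Function.update s q a) ↔ A q s) :
    prob (strictlyCausalPMF PS PYX f) {ω | ω.2.1 ω.1 = s₀ ∧ A ω.1 ω.2.1}
      = PS s₀ * prob (strictlyCausalPMF PS PYX f) {ω | A ω.1 ω.2.1} := by
  classical
  rw [prob_strictlyCausalPMF_source hPYX A,
    prob_strictlyCausalPMF_source hPYX fun q s => s q = s₀ ∧ A q s, Finset.mul_sum]
  refine Finset.sum_congr rfl fun q _ => ?_
  rw [mul_left_comm, ← IsPMF.sum_prod_ite_eval_and (p := fun _ => PS) q hPS s₀ (A q) (hA q)]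
  congr!

theorem prob_strictlyCausalPMF_source_eval (hn : 0 < n) (hPS : IsPMF PS)
    (hPYX : ∀ x, IsPMF (PYX x)) (s₀ : S) :
    prob (strictlyCausalPMF PS PYX f) {ω | ω.2.1 ω.1 = s₀} = PS s₀ := by
  have h := prob_strictlyCausalPMF_source_eval_and (f := f) hPS hPYX s₀ (fun _ _ => True)
    fun _ _ _ => Iff.rfl
  rw [prob_strictlyCausalPMF_source hPYX fun _ _ => True] at h
  have hn' : (n : ℝ) ≠ 0 := by positivity
  simpa [IsPMF.sum_prod_eq_one (p := fun _ : Fin n => PS) fun _ => hPS, hn'] using h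

theorem prob_strictlyCausalPMF_output_eval_and (hPYX : ∀ x, IsPMF (PYX x))
    (x₀ : X) (y₀ : Y) (A : Fin n → (Fin n → S) → (Fin n → Y) → Prop)
    (hA : ∀ q s y b, A q s (Function.update y q b) ↔ A q s y) :
    prob (strictlyCausalPMF PS PYX f)
        {ω | A ω.1 ω.2.1 ω.2.2 ∧ f ω.1 (fun j => ω.2.1 j.1) = x₀ ∧ ω.2.2 ω.1 = y₀}
      = PYX x₀ y₀ * prob (strictlyCausalPMF PS PYX f)
          {ω | A ω.1 ω.2.1 ω.2.2 ∧ f ω.1 (fun j => ω.2.1 j.1) = x₀} := by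
  classical
  rw [prob_triple_eq_sum, prob_triple_eq_sum, Finset.mul_sum]
  refine Finset.sum_congr rfl fun q _ => ?_
  rw [Finset.mul_sum]
  refine Finset.sum_congr rfl fun s _ => ?_
  simp only [Set.mem_ofPred_eq, strictlyCausalPMF]
  by_cases hx : f q (fun j => s j.1) = x₀
  · have h := IsPMF.sum_prod_ite_eval_and (p := fun i => PYX (f i fun j => s j.1)) q (hPYX _) y₀
      (A q s) (hA q s)
    simp only [hx, true_and, and_true, and_comm (a := A q s _) (b := _ = y₀)] at h ⊢
    simp only [← mul_ite_zero, ← Finset.mul_sum, h]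
    ring
  · simp [hx]

open Classical in
/-- Conditionally on `(Q, S^{Q-1}, Y_Q, Y_{Q+1}ⁿ)`, the source sequence and the output sequence
are independent. -/
theorem exists_prob_strictlyCausalPMF_factor
    (y₀ : Y) (q : Fin n) (u : {j : Fin n // j < q} → S) (v : {j : Fin n // q < j} → Y) :
    ∃ (F : ((Fin n → S) → Prop) → ℝ) (G : ((Fin n → Y) → Prop) → ℝ), ∀ A B,
      prob (strictlyCausalPMF PS PYX f)
        {ω | (A ω.2.1 ∧ B ω.2.2) ∧ ω.2.2 ω.1 = y₀ ∧
          (⟨ω.1, fun j => ω.2.1 j.1, fun j => ω.2.2 j.1⟩ :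
            (q : Fin n) × (({j : Fin n // j < q} → S) × ({j : Fin n // q < j} → Y)))
            = ⟨q, u, v⟩} = F A * G B := by
  let c : Fin n → Y := fun i => if h : q < i then v ⟨i, h⟩ else y₀
  let w : Fin n → Y → ℝ := fun i b =>
    if h : i < q then PYX (f i fun j => u ⟨j.1, j.2.trans h⟩) b else 1
  let W : (Fin n → S) → Fin n → ℝ := fun s i =>
    if i < q then 1 else PYX (f i fun j => s j.1) (c i)
  refine ⟨fun A => ∑ s : Fin n → S, if A s ∧ (fun j : {j : Fin n // j < q} => s j.1) = u then
      (1 / (n : ℝ)) * (∏ i, PS (s i)) * ∏ i, W s i else 0,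
    fun B => ∑ y : Fin n → Y, if B y ∧ y q = y₀ ∧
      (fun j : {j : Fin n // q < j} => y j.1) = v then ∏ i, w i (y i) else 0, fun A B => ?_⟩
  rw [prob_triple_eq_sum, Finset.sum_eq_single q, Finset.sum_mul_sum]
  · refine Finset.sum_congr rfl fun s _ => Finset.sum_congr rfl fun y _ => ?_
    simp only [Set.mem_ofPred_eq, Sigma.mk.injEq, heq_eq_eq, true_and, Prod.mk.injEq]
    by_cases hs : A s ∧ (fun j : {j : Fin n // j < q} => s j.1) = u
    · by_cases hy : B y ∧ y q = y₀ ∧ (fun j : {j : Fin n // q < j} => y j.1) = v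
      · rw [if_pos ⟨⟨hs.1, hy.1⟩, hy.2.1, hs.2, hy.2.2⟩, if_pos hs, if_pos hy, strictlyCausalPMF,
          mul_assoc _ (∏ i, W s i), ← Finset.prod_mul_distrib]
        congr 1
        refine Finset.prod_congr rfl fun i _ => ?_
        obtain ⟨-, rfl⟩ := hs
        obtain ⟨-, rfl, rfl⟩ := hy
        rcases lt_trichotomy i q with h | rfl | h
        · simp [W, w, h]
        · simp [W, w, c]
        · simp [W, w, c, h, h.not_gt]
      · rw [if_neg (fun h => hy ⟨h.1.2, h.2.1, h.2.2.2⟩), if_neg hy, mul_zero]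
    · rw [if_neg (fun h => hs ⟨h.1.1, h.2.2.1⟩), if_neg hs, zero_mul]
  · intro q' _ hq'
    refine Finset.sum_eq_zero fun s _ => Finset.sum_eq_zero fun y _ => if_neg fun h => hq' ?_
    exact congrArg Sigma.fst h.2.2
  · exact fun h => absurd (Finset.mem_univ q) h

end StrictlyCausal

/-- **Converse Markov-chain lemma for strictly causal encoding.**
`S₁,…,Sₙ` i.i.d. `P_S`; `Xᵢ = fᵢ(Sⁱ⁻¹)`; memoryless channel `P_{Y|X}`;
`Ŝᵢ = gᵢ(Yⁿ)`; `Q` uniform on `{1,…,n}` independent of everything (so the joint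
pmf of `(Q,Sⁿ,Yⁿ)` is `P(q,sⁿ,yⁿ) = (1/n)·∏ᵢP_S(sᵢ)·∏ᵢP_{Y|X}(yᵢ|xᵢ)`), and
`V = (S^{Q−1}, Y_{Q+1}ⁿ, Q)`.  Then:
(i) `S_Q ⫫ X_Q`;
(ii) `(S_Q,V) — X_Q — Y_Q` is a Markov chain;
(iii) `(S_Q,X_Q) — (Y_Q,V) — Ŝ_Q` is a Markov chain. -/
theorem strictly_causal_converse_markov_lemma
    {S X Y Z : Type} [Fintype S] [Fintype X] [Fintype Y] [Fintype Z]
    (PS : S → ℝ) (PYX : X → Y → ℝ)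
    (hPS : IsPMF PS) (hPYX : ∀ x, IsPMF (PYX x))
    (n : ℕ) (hn : 0 < n)
    (f : (i : Fin n) → ({j : Fin n // j < i} → S) → X)
    (g : Fin n → (Fin n → Y) → Z)
    (P : Fin n × (Fin n → S) × (Fin n → Y) → ℝ)
    (hP : ∀ (q : Fin n) (s : Fin n → S) (y : Fin n → Y),
      P (q, s, y) = (1 / (n : ℝ)) * (∏ i, PS (s i)) *
        ∏ i, PYX (f i (fun j => s j.1)) (y i))
    (SQ : Fin n × (Fin n → S) × (Fin n → Y) → S)
    (hSQ : ∀ ω, SQ ω = ω.2.1 ω.1)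
    (XQ : Fin n × (Fin n → S) × (Fin n → Y) → X)
    (hXQ : ∀ ω, XQ ω = f ω.1 (fun j => ω.2.1 j.1))
    (YQ : Fin n × (Fin n → S) × (Fin n → Y) → Y)
    (hYQ : ∀ ω, YQ ω = ω.2.2 ω.1)
    (ZQ : Fin n × (Fin n → S) × (Fin n → Y) → Z)
    (hZQ : ∀ ω, ZQ ω = g ω.1 ω.2.2)
    (V : Fin n × (Fin n → S) × (Fin n → Y) →
      (q : Fin n) × (({j : Fin n // j < q} → S) × ({j : Fin n // q < j} → Y)))
    (hV : ∀ ω, V ω = ⟨ω.1, fun j => ω.2.1 j.1, fun j => ω.2.2 j.1⟩) :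
    -- (i) `S_Q` is independent of `X_Q`
    (∀ (s0 : S) (x0 : X),
      margProb P (fun ω => (SQ ω, XQ ω)) (s0, x0)
        = margProb P SQ s0 * margProb P XQ x0) ∧
    -- (ii) `(S_Q, V) — X_Q — Y_Q`
    (∀ (s0 : S)
        (v0 : (q : Fin n) × (({j : Fin n // j < q} → S) × ({j : Fin n // q < j} → Y)))
        (x0 : X) (y0 : Y),
      0 < margProb P XQ x0 →
      margProb P (fun ω => ((SQ ω, V ω), XQ ω, YQ ω)) ((s0, v0), x0, y0)
          / margProb P XQ x0
        = (margProb P (fun ω => ((SQ ω, V ω), XQ ω)) ((s0, v0), x0)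
            / margProb P XQ x0)
          * (margProb P (fun ω => (XQ ω, YQ ω)) (x0, y0)
            / margProb P XQ x0)) ∧
    -- (iii) `(S_Q, X_Q) — (Y_Q, V) — Ŝ_Q`
    (∀ (s0 : S) (x0 : X) (y0 : Y)
        (v0 : (q : Fin n) × (({j : Fin n // j < q} → S) × ({j : Fin n // q < j} → Y)))
        (z0 : Z),
      0 < margProb P (fun ω => (YQ ω, V ω)) (y0, v0) →
      margProb P (fun ω => ((SQ ω, XQ ω), (YQ ω, V ω), ZQ ω)) ((s0, x0), (y0, v0), z0)
          / margProb P (fun ω => (YQ ω, V ω)) (y0, v0)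
        = (margProb P (fun ω => ((SQ ω, XQ ω), YQ ω, V ω)) ((s0, x0), y0, v0)
            / margProb P (fun ω => (YQ ω, V ω)) (y0, v0))
          * (margProb P (fun ω => ((YQ ω, V ω), ZQ ω)) ((y0, v0), z0)
            / margProb P (fun ω => (YQ ω, V ω)) (y0, v0))) := by
  obtain rfl : P = strictlyCausalPMF PS PYX f := funext fun ω => hP ω.1 ω.2.1 ω.2.2
  obtain rfl := funext hSQ
  obtain rfl := funext hXQ
  obtain rfl := funext hYQ
  obtain rfl := funext hZQ
  obtain rfl := funext hV
  have past_update : ∀ {α : Type} (q : Fin n) (s : Fin n → α) (a : α),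
      (fun j : {j : Fin n // j < q} => Function.update s q a j.1) = fun j => s j.1 :=
    fun q s a => funext fun j => Function.update_of_ne j.2.ne _ _
  have future_update : ∀ {α : Type} (q : Fin n) (s : Fin n → α) (a : α),
      (fun j : {j : Fin n // q < j} => Function.update s q a j.1) = fun j => s j.1 :=
    fun q s a => funext fun j => Function.update_of_ne j.2.ne' _ _
  refine ⟨fun s0 x0 => ?_, fun s0 v0 x0 y0 hx => ?_, ?_⟩
  · simp only [margProb, Prod.mk.injEq]
    rw [prob_strictlyCausalPMF_source_eval hn hPS hPYX]
    exact prob_strictlyCausalPMF_source_eval_and hPS hPYX s0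
      (fun q s => f q (fun j => s j.1) = x0) fun q s a => by rw [past_update]
  · have hjoint := prob_strictlyCausalPMF_output_eval_and (PS := PS) (f := f) hPYX x0 y0
      (fun q s y => s q = s0 ∧ (⟨q, fun j => s j.1, fun j => y j.1⟩ :
        (q : Fin n) × (({j : Fin n // j < q} → S) × ({j : Fin n // q < j} → Y))) = v0)
      fun q s y b => by rw [future_update]
    have hmarg := prob_strictlyCausalPMF_output_eval_and (PS := PS) (f := f) hPYX x0 y0
      (fun _ _ _ => True) fun _ _ _ _ => Iff.rfl
    simp only [true_and] at hmarg
    simp only [margProb, Prod.mk.injEq] at hx ⊢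
    rw [hjoint, hmarg]
    field_simp
  · rintro s0 x0 y0 ⟨q, u, v⟩ z0 h
    obtain ⟨F, G, hFG⟩ := exists_prob_strictlyCausalPMF_factor (PS := PS) (PYX := PYX) (f := f)
      y0 q u v
    let A : (Fin n → S) → Prop := fun s => s q = s0 ∧ f q (fun j => s j.1) = x0
    let B : (Fin n → Y) → Prop := fun y => g q y = z0
    have hden : margProb (strictlyCausalPMF PS PYX f) (fun ω => (ω.2.2 ω.1,
        (⟨ω.1, fun j => ω.2.1 j.1, fun j => ω.2.2 j.1⟩ :
          (q : Fin n) × (({j : Fin n // j < q} → S) × ({j : Fin n // q < j} → Y)))))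
        (y0, ⟨q, u, v⟩) = F (fun _ => True) * G (fun _ => True) := by
      rw [← hFG, margProb]
      congr 1
      ext ω
      simp only [Set.mem_ofPred_eq, Prod.mk.injEq, true_and, and_true]
    have hsource : margProb (strictlyCausalPMF PS PYX f)
        (fun ω => ((ω.2.1 ω.1, f ω.1 (fun j => ω.2.1 j.1)), ω.2.2 ω.1,
          (⟨ω.1, fun j => ω.2.1 j.1, fun j => ω.2.2 j.1⟩ :
            (q : Fin n) × (({j : Fin n // j < q} → S) × ({j : Fin n // q < j} → Y)))))
        ((s0, x0), y0, ⟨q, u, v⟩) = F A * G (fun _ => True) := by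
      rw [← hFG, margProb]
      congr 1
      ext ⟨q', s, y⟩
      by_cases hq : q' = q
      · subst hq
        simp only [Set.mem_ofPred_eq, Prod.mk.injEq, and_true, A]
      · simp [hq]
    have hdecoder : margProb (strictlyCausalPMF PS PYX f)
        (fun ω => ((ω.2.2 ω.1,
          (⟨ω.1, fun j => ω.2.1 j.1, fun j => ω.2.2 j.1⟩ :
            (q : Fin n) × (({j : Fin n // j < q} → S) × ({j : Fin n // q < j} → Y)))),
          g ω.1 ω.2.2))
        ((y0, ⟨q, u, v⟩), z0) = F (fun _ => True) * G B := by
      rw [← hFG, margProb]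
      congr 1
      ext ⟨q', s, y⟩
      by_cases hq : q' = q
      · subst hq
        simp only [Set.mem_ofPred_eq, Prod.mk.injEq, true_and, B]
        tauto
      · simp [hq]
    have hall : margProb (strictlyCausalPMF PS PYX f)
        (fun ω => ((ω.2.1 ω.1, f ω.1 (fun j => ω.2.1 j.1)), (ω.2.2 ω.1,
          (⟨ω.1, fun j => ω.2.1 j.1, fun j => ω.2.2 j.1⟩ :
            (q : Fin n) × (({j : Fin n // j < q} → S) × ({j : Fin n // q < j} → Y)))),
          g ω.1 ω.2.2))
        ((s0, x0), (y0, ⟨q, u, v⟩), z0) = F A * G B := by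
      rw [← hFG, margProb]
      congr 1
      ext ⟨q', s, y⟩
      by_cases hq : q' = q
      · subst hq
        simp only [Set.mem_ofPred_eq, Prod.mk.injEq, A, B]
        tauto
      · simp [hq]
    rw [hden] at h
    rw [hall, hsource, hdecoder, hden]
    have hF : F (fun _ => True) ≠ 0 := left_ne_zero_of_mul h.ne'
    have hG : G (fun _ => True) ≠ 0 := right_ne_zero_of_mul h.ne'
    field_simp

end
end

section
/- Deterministic restriction in the Theorem 1 inner bound: the inner-bound region is unchanged if the conditional pmfs P_{X|US} and P_{Ŝ|UY} are restricted to deterministic functions. Precisely, if there exist a finite set 𝒰 and a joint pmf P_{SXYŜU} factoring as P_S·P_{U|S}·P_{X|US}·P_{Y|X}·P_{Ŝ|UY} with I(U;S) ≤ I(U;Y), then there exist a finite set 𝒰', a conditional pmf P_{U'|S}, and functions x : 𝒮×𝒰' → 𝒳 and ŝ : 𝒰'×𝒴 → Ŝ such that the joint pmf of (S, U', X, Y, Ŝ) with S ∼ P_S, U' ∼ P_{U'|S}(·|S), X = x(S,U'), Y ∼ P_{Y|X}(·|X), Ŝ = ŝ(U',Y) has the same (S,X,Y,Ŝ)-marginal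 as P_{SXYŜU} and satisfies I(U';S) ≤ I(U';Y). -/
noncomputable section

open Finset in
/-- The log-sum inequality, for logarithms to base 2. -/
theorem sum_mul_logb_div_le_sum {ι : Type*} (s : Finset ι) (a b : ι → ℝ)
    (ha : ∀ i ∈ s, 0 ≤ a i) (hb : ∀ i ∈ s, 0 ≤ b i) (hab : ∀ i ∈ s, b i = 0 → a i = 0) :
    (∑ i ∈ s, a i) * Real.logb 2 ((∑ i ∈ s, a i) / ∑ i ∈ s, b i) ≤
      ∑ i ∈ s, a i * Real.logb 2 (a i / b i) := by
  set A := ∑ i ∈ s, a i with hA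
  set B := ∑ i ∈ s, b i with hB
  rcases (sum_nonneg ha).eq_or_lt with hA0 | hA0
  · have h0 : ∀ i ∈ s, a i = 0 := (sum_eq_zero_iff_of_nonneg ha).1 hA0.symm
    rw [hA, ← hA0, zero_mul, sum_eq_zero]
    intro i hi
    rw [h0 i hi, zero_mul]
  · have hB0 : 0 < B := by
      refine (sum_nonneg hb).lt_of_ne' fun h ↦ hA0.ne' ?_
      exact sum_eq_zero fun i hi ↦ hab i hi ((sum_eq_zero_iff_of_nonneg hb).1 h i hi)
    have hlog : A * Real.log (A / B) ≤ ∑ i ∈ s, a i * Real.log (a i / b i) := by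
      have hterm : ∀ i ∈ s,
          a i * Real.log (A / B) + (a i - b i * (A / B)) ≤ a i * Real.log (a i / b i) := by
        intro i hi
        rcases (ha i hi).eq_or_lt with h | h
        · rw [← h]
          have := mul_nonneg (hb i hi) (div_pos hA0 hB0).le
          linarith
        · have hbi : 0 < b i := (hb i hi).lt_of_ne' fun h' ↦ h.ne' (hab i hi h')
          have h1 := Real.one_sub_inv_le_log_of_pos
            (div_pos (div_pos h hbi) (div_pos hA0 hB0))
          rw [Real.log_div (div_pos h hbi).ne' (div_pos hA0 hB0).ne'] at h1
          have h2 := mul_le_mul_of_nonneg_left h1 h.le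
          have h3 : a i * (1 - (a i / b i / (A / B))⁻¹) = a i - b i * (A / B) := by
            field_simp
          linarith
      have hsum := sum_le_sum hterm
      rw [sum_add_distrib, sum_sub_distrib, ← sum_mul, ← sum_mul, ← hA, ← hB,
        mul_div_cancel₀ _ hB0.ne'] at hsum
      linarith
    simp only [Real.logb, mul_div_assoc', ← sum_div]
    exact div_le_div_of_nonneg_right hlog (Real.log_nonneg one_le_two)

open Classical in
theorem margProb_eq_sum_ite {Ω A : Type*} [Fintype Ω] (P : Ω → ℝ) (f : Ω → A) (a : A) :
    margProb P f a = ∑ ω, if f ω = a then P ω else 0 := by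
  simp [margProb, prob, Set.indicator_apply]

theorem margProb_nonneg {Ω A : Type*} [Fintype Ω] {P : Ω → ℝ} (hP : ∀ ω, 0 ≤ P ω)
    (f : Ω → A) (a : A) : 0 ≤ margProb P f a :=
  Finset.sum_nonneg fun ω _ ↦ Set.indicator_nonneg (fun ω _ ↦ hP ω) ω

open Classical in
theorem margProb_comp {Ω A C : Type*} [Fintype Ω] [Fintype A] (P : Ω → ℝ) (f : Ω → A)
    (π : A → C) (c : C) :
    margProb P (fun ω ↦ π (f ω)) c = ∑ a with π a = c, margProb P f a := by
  simp only [margProb_eq_sum_ite]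
  rw [Finset.sum_comm]
  refine Finset.sum_congr rfl fun ω _ ↦ ?_
  rw [Finset.sum_filter, Finset.sum_eq_single (f ω)] <;> simp +contextual [eq_comm]

theorem margProb_eq_sum_right {Ω A B : Type*} [Fintype Ω] [Fintype B] (P : Ω → ℝ)
    (f : Ω → A) (g : Ω → B) (a : A) :
    margProb P f a = ∑ b, margProb P (fun ω ↦ (f ω, g ω)) (a, b) := by
  classical
  simp only [margProb_eq_sum_ite]
  rw [Finset.sum_comm]
  refine Finset.sum_congr rfl fun ω _ ↦ ?_
  by_cases h : f ω = a <;> simp [h]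

theorem margProb_eq_sum_left {Ω A B : Type*} [Fintype Ω] [Fintype A] (P : Ω → ℝ)
    (f : Ω → A) (g : Ω → B) (b : B) :
    margProb P g b = ∑ a, margProb P (fun ω ↦ (f ω, g ω)) (a, b) := by
  classical
  simp only [margProb_eq_sum_ite]
  rw [Finset.sum_comm]
  refine Finset.sum_congr rfl fun ω _ ↦ ?_
  by_cases h : g ω = b <;> simp [h]

open Classical in
theorem margProb_comp_prod {Ω A B C : Type*} [Fintype Ω] [Fintype A] (P : Ω → ℝ)
    (f : Ω → A) (g : Ω → B) (π : A → C) (c : C) (b : B) :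
    margProb P (fun ω ↦ (π (f ω), g ω)) (c, b) =
      ∑ a with π a = c, margProb P (fun ω ↦ (f ω, g ω)) (a, b) := by
  simp only [margProb_eq_sum_ite]
  rw [Finset.sum_comm]
  refine Finset.sum_congr rfl fun ω _ ↦ ?_
  rw [Finset.sum_filter, Finset.sum_eq_single (f ω)]
  · by_cases h : π (f ω) = c <;> simp [h]
  · intro a _ ha
    simp [ha.symm]
  · simp

/-- Data processing: applying a function to one variable does not increase mutual information. -/
theorem mutInfo_comp_le {Ω A B C : Type*} [Fintype Ω] [Fintype A] [Fintype B] [Fintype C]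
    {P : Ω → ℝ} (hP : ∀ ω, 0 ≤ P ω) (f : Ω → A) (g : Ω → B) (π : A → C) :
    mutInfo P (fun ω ↦ π (f ω)) g ≤ mutInfo P f g := by
  classical
  unfold mutInfo
  rw [← Finset.sum_fiberwise Finset.univ π]
  refine Finset.sum_le_sum fun c _ ↦ ?_
  rw [Finset.sum_comm]
  refine Finset.sum_le_sum fun b _ ↦ ?_
  rw [margProb_comp_prod, margProb_comp, Finset.sum_mul _ _ (margProb P g b)]
  refine sum_mul_logb_div_le_sum _ _ _ (fun a _ ↦ margProb_nonneg hP _ _)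
    (fun a _ ↦ mul_nonneg (margProb_nonneg hP _ _) (margProb_nonneg hP _ _)) fun a _ h ↦ ?_
  rcases mul_eq_zero.1 h with h | h
  · rw [margProb_eq_sum_right P f g] at h
    exact (Finset.sum_eq_zero_iff_of_nonneg fun b _ ↦ margProb_nonneg hP _ _).1 h b
      (Finset.mem_univ b)
  · rw [margProb_eq_sum_left P f g] at h
    exact (Finset.sum_eq_zero_iff_of_nonneg fun a _ ↦ margProb_nonneg hP _ _).1 h a
      (Finset.mem_univ a)

open Classical in
/-- Refining a variable by conditionally independent extra randomness preserves mutual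
information. -/
theorem mutInfo_eq_of_fiberwise_weights {Ω Ω' A A' B : Type*} [Fintype Ω] [Fintype Ω']
    [Fintype A] [Fintype A'] [Fintype B] (P : Ω → ℝ) (P' : Ω' → ℝ) (f : Ω → A) (g : Ω → B)
    (f' : Ω' → A') (g' : Ω' → B) (π : A' → A) (w : A' → ℝ)
    (hw : ∀ a, ∑ a' with π a' = a, w a' = 1)
    (hJ : ∀ a' b, margProb P' (fun ω ↦ (f' ω, g' ω)) (a', b) =
      w a' * margProb P (fun ω ↦ (f ω, g ω)) (π a', b)) :
    mutInfo P' f' g' = mutInfo P f g := by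
  have hf : ∀ a', margProb P' f' a' = w a' * margProb P f (π a') := fun a' ↦ by
    simp only [margProb_eq_sum_right P' f' g', margProb_eq_sum_right P f g, hJ, Finset.mul_sum]
  have hg : ∀ b, margProb P' g' b = margProb P g b := fun b ↦ by
    simp only [margProb_eq_sum_left P' f' g', margProb_eq_sum_left P f g, hJ]
    rw [← Finset.sum_fiberwise Finset.univ π]
    refine Finset.sum_congr rfl fun a _ ↦ ?_
    rw [← one_mul (margProb P _ (a, b)), ← hw a, Finset.sum_mul]
    refine Finset.sum_congr rfl fun a' ha' ↦ ?_
    rw [(Finset.mem_filter.1 ha').2]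
  unfold mutInfo
  rw [← Finset.sum_fiberwise Finset.univ π]
  refine Finset.sum_congr rfl fun a _ ↦ ?_
  rw [Finset.sum_comm]
  refine Finset.sum_congr rfl fun b _ ↦ ?_
  conv_rhs => rw [← one_mul (_ * _), ← hw a, Finset.sum_mul]
  refine Finset.sum_congr rfl fun a' ha' ↦ ?_
  rw [hJ, hf, hg, (Finset.mem_filter.1 ha').2, mul_assoc, mul_assoc]
  by_cases h : w a' = 0
  · simp [h]
  · rw [mul_div_mul_left _ _ h]

theorem margProb_eq_of_law {Ω Ω' A : Type*} [Fintype Ω] [Fintype Ω'] {P : Ω → ℝ} {P' : Ω' → ℝ}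
    {T : Ω' → Ω} (hT : ∀ ω, margProb P' T ω = P ω) (f : Ω → A) (a : A) :
    margProb P f a = margProb P' (fun ω ↦ f (T ω)) a := by
  classical
  rw [margProb_comp P' T f, margProb_eq_sum_ite, Finset.sum_filter]
  simp only [hT]

theorem mutInfo_eq_of_law {Ω Ω' A B : Type*} [Fintype Ω] [Fintype Ω'] [Fintype A] [Fintype B]
    {P : Ω → ℝ} {P' : Ω' → ℝ} {T : Ω' → Ω} (hT : ∀ ω, margProb P' T ω = P ω)
    (f : Ω → A) (g : Ω → B) :
    mutInfo P f g = mutInfo P' (fun ω ↦ f (T ω)) (fun ω ↦ g (T ω)) := by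
  simp only [mutInfo, margProb_eq_of_law hT]

theorem isPMF_ite_eq {α : Type*} [Fintype α] [DecidableEq α] (b : α) :
    IsPMF fun a ↦ if a = b then (1 : ℝ) else 0 :=
  ⟨fun a ↦ by positivity, by simp⟩

/-- A product of pmfs has total mass one on the function space. -/
theorem sum_prod_apply_eq_one {α β : Type*} [Fintype α] [DecidableEq α] [Fintype β]
    {p : α → β → ℝ} (hp : ∀ a, IsPMF (p a)) : ∑ h : α → β, ∏ a, p a (h a) = 1 := by
  rw [← Fintype.piFinset_univ, ← Finset.prod_univ_sum]
  exact Finset.prod_eq_one fun a _ ↦ (hp a).2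

theorem sum_prod_apply_mul_ite {α β : Type*} [Fintype α] [DecidableEq α] [Fintype β]
    [DecidableEq β] {p : α → β → ℝ} (hp : ∀ a, IsPMF (p a)) (a : α) (b : β) :
    ∑ h : α → β, (∏ a', p a' (h a')) * (if b = h a then 1 else 0) = p a b := by
  have key : ∀ h : α → β, (∏ a', p a' (h a')) * (if b = h a then 1 else 0) =
      ∏ a', p a' (h a') * (if a' = a then if b = h a' then 1 else 0 else 1) := fun h ↦ by
    rw [Finset.prod_mul_distrib, Finset.prod_ite_eq' Finset.univ a, if_pos (Finset.mem_univ a)]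
  simp only [key]
  rw [← Fintype.piFinset_univ, ← Finset.prod_univ_sum (fun _ ↦ Finset.univ)
    (fun a' c ↦ p a' c * (if a' = a then if b = c then 1 else 0 else 1)),
    Finset.prod_eq_single a]
  · simp
  · intro a' _ h
    simp [h, (hp a').2]
  · simp

theorem margProb_auxiliary_source {S X Y Z U : Type*} [Fintype S] [Fintype X] [Fintype Y]
    [Fintype Z] [Fintype U] {p : S → U → ℝ} {PX : U → S → X → ℝ} {PYX : X → Y → ℝ}
    {PZ : U → Y → Z → ℝ} (hPX : ∀ u s, IsPMF (PX u s)) (hPYX : ∀ x, IsPMF (PYX x))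
    (hPZ : ∀ u y, IsPMF (PZ u y)) {Q : S × X × Y × Z × U → ℝ}
    (hQ : ∀ s x y z u, Q (s, x, y, z, u) = p s u * PX u s x * PYX x y * PZ u y z)
    (u : U) (s : S) :
    margProb Q (fun ω ↦ (ω.2.2.2.2, ω.1)) (u, s) = p s u := by
  classical
  rw [margProb_eq_sum_ite]
  simp only [Fintype.sum_prod_type, hQ, Prod.mk.injEq, ite_and]
  simp [← Finset.mul_sum, (hPZ _ _).2, (hPYX _).2, (hPX _ _).2]

/-- **Deterministic restriction in the Theorem 1 inner bound.**
If there are a finite set `U` and a joint pmf `Q` on `S × X × Y × Ŝ × U` factoring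
as `P_S · P_{U|S} · P_{X|US} · P_{Y|X} · P_{Ŝ|UY}` with `I(U;S) ≤ I(U;Y)`, then
there are a finite set `𝒰' = Fin m`, a conditional pmf `P_{U'|S}` and
deterministic maps `x : S × U' → X`, `ŝ : U' × Y → Ŝ` such that the corresponding
joint pmf `Q'` of `(S,X,Y,Ŝ,U')` (with `X = x(S,U')` and `Ŝ = ŝ(U',Y)`) has the
same `(S,X,Y,Ŝ)`-marginal as `Q` and satisfies `I(U';S) ≤ I(U';Y)`. -/
theorem inner_bound_deterministic_restriction
    {S X Y Z U : Type} [Fintype S] [Fintype X] [Fintype Y] [Fintype Z] [Fintype U]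
    [DecidableEq X] [DecidableEq Z]
    (PS : S → ℝ) (PYX : X → Y → ℝ)
    (hPS : IsPMF PS) (hPYX : ∀ x, IsPMF (PYX x))
    (PUgS : S → U → ℝ) (PXgUS : U → S → X → ℝ) (PZgUY : U → Y → Z → ℝ)
    (hPUgS : ∀ s, IsPMF (PUgS s)) (hPXgUS : ∀ u s, IsPMF (PXgUS u s))
    (hPZgUY : ∀ u y, IsPMF (PZgUY u y))
    (Q : S × X × Y × Z × U → ℝ)
    (hQ : ∀ s x y z u,
      Q (s, x, y, z, u) = PS s * PUgS s u * PXgUS u s x * PYX x y * PZgUY u y z)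
    (hMI : mutInfo Q (fun ω => ω.2.2.2.2) (fun ω => ω.1)
         ≤ mutInfo Q (fun ω => ω.2.2.2.2) (fun ω => ω.2.2.1)) :
    ∃ (m : ℕ) (PU'gS : S → Fin m → ℝ) (xf : S → Fin m → X) (sf : Fin m → Y → Z)
      (Q' : S × X × Y × Z × Fin m → ℝ),
      (∀ s, IsPMF (PU'gS s)) ∧
      (∀ s x y z u',
        Q' (s, x, y, z, u') = PS s * PU'gS s u' * (if x = xf s u' then 1 else 0) *
          PYX x y * (if z = sf u' y then 1 else 0)) ∧
      (∀ s x y z, (∑ u, Q (s, x, y, z, u)) = ∑ u', Q' (s, x, y, z, u')) ∧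
      mutInfo Q' (fun ω => ω.2.2.2.2) (fun ω => ω.1)
        ≤ mutInfo Q' (fun ω => ω.2.2.2.2) (fun ω => ω.2.2.1) := by
  classical
  let V := U × (S → X) × (Y → Z)
  let e : Fin (Fintype.card V) ≃ V := (Fintype.equivFin V).symm
  let wV : V → ℝ := fun v ↦ (∏ s, PXgUS v.1 s (v.2.1 s)) * ∏ y, PZgUY v.1 y (v.2.2 y)
  let π : Fin (Fintype.card V) → U := fun i ↦ (e i).1
  let w : Fin (Fintype.card V) → ℝ := fun i ↦ wV (e i)
  let xf : S → Fin (Fintype.card V) → X := fun s i ↦ (e i).2.1 s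
  let sf : Fin (Fintype.card V) → Y → Z := fun i y ↦ (e i).2.2 y
  let Q' : S × X × Y × Z × Fin (Fintype.card V) → ℝ := fun ω ↦
    PS ω.1 * (PUgS ω.1 (π ω.2.2.2.2) * w ω.2.2.2.2) *
      (if ω.2.1 = xf ω.1 ω.2.2.2.2 then 1 else 0) * PYX ω.2.1 ω.2.2.1 *
      (if ω.2.2.2.1 = sf ω.2.2.2.2 ω.2.2.1 then 1 else 0)
  have hw0 : ∀ i, 0 ≤ w i := fun i ↦
    mul_nonneg (Finset.prod_nonneg fun s _ ↦ (hPXgUS _ s).1 _)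
      (Finset.prod_nonneg fun y _ ↦ (hPZgUY _ y).1 _)
  have hfiber : ∀ (F : V → ℝ) (u : U),
      ∑ i with π i = u, F (e i) = ∑ a : S → X, ∑ b : Y → Z, F (u, a, b) := fun F u ↦ by
    rw [Finset.sum_filter, e.sum_comp fun v ↦ if v.1 = u then F v else 0]
    simp only [V, Fintype.sum_prod_type]
    rw [Finset.sum_eq_single u] <;> simp +contextual
  have hw1 : ∀ u, ∑ i with π i = u, w i = 1 := fun u ↦ by
    rw [hfiber wV]
    simp only [wV, ← Finset.mul_sum, sum_prod_apply_eq_one (hPZgUY u), mul_one,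
      sum_prod_apply_eq_one (hPXgUS u)]
  have hQ'_nonneg : ∀ ω, 0 ≤ Q' ω := fun ω ↦ by
    have h1 := hPS.1 ω.1
    have h2 := (hPUgS ω.1).1 (π ω.2.2.2.2)
    have h3 := hw0 ω.2.2.2.2
    have h4 := (hPYX ω.2.1).1 ω.2.2.1
    simp only [Q']
    positivity
  have hsum : ∀ s x y z u, ∑ i with π i = u, Q' (s, x, y, z, i) = Q (s, x, y, z, u) := by
    intro s x y z u
    rw [hfiber fun v ↦ PS s * (PUgS s v.1 * wV v) * (if x = v.2.1 s then 1 else 0) *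
      PYX x y * (if z = v.2.2 y then 1 else 0), hQ, ← sum_prod_apply_mul_ite (hPXgUS u) s x,
      ← sum_prod_apply_mul_ite (hPZgUY u) y z]
    simp only [wV, Finset.mul_sum, Finset.sum_mul]
    rw [Finset.sum_comm]
    exact Finset.sum_congr rfl fun _ _ ↦ Finset.sum_congr rfl fun _ _ ↦ by ring
  have hlaw : ∀ ω, margProb Q' (fun ω' ↦ (ω'.1, ω'.2.1, ω'.2.2.1, ω'.2.2.2.1, π ω'.2.2.2.2)) ω
      = Q ω := by
    rintro ⟨s, x, y, z, u⟩
    rw [margProb_eq_sum_ite, ← hsum, Finset.sum_filter]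
    simp only [Fintype.sum_prod_type, Prod.mk.injEq, ite_and]
    simp
  refine ⟨_, fun s i ↦ PUgS s (π i) * w i, xf, sf, Q', fun s ↦ ⟨fun i ↦
    mul_nonneg ((hPUgS s).1 _) (hw0 i), ?_⟩, fun _ _ _ _ _ ↦ rfl, fun s x y z ↦ ?_, ?_⟩
  · rw [← Finset.sum_fiberwise Finset.univ π, ← (hPUgS s).2]
    refine Finset.sum_congr rfl fun u _ ↦ ?_
    rw [← mul_one (PUgS s u), ← hw1 u, Finset.mul_sum]
    refine Finset.sum_congr rfl fun i hi ↦ ?_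
    simp only [(Finset.mem_filter.1 hi).2]
  · simp only [← hsum]
    exact Finset.sum_fiberwise _ _ _
  · calc mutInfo Q' (fun ω ↦ ω.2.2.2.2) (fun ω ↦ ω.1)
        = mutInfo Q (fun ω ↦ ω.2.2.2.2) (fun ω ↦ ω.1) := by
          refine mutInfo_eq_of_fiberwise_weights _ _ _ _ _ _ π w hw1 fun i s ↦ ?_
          rw [margProb_auxiliary_source hPXgUS hPYX hPZgUY hQ,
            margProb_auxiliary_source (p := fun s i ↦ PS s * (PUgS s (π i) * w i))
              (fun i s ↦ isPMF_ite_eq (xf s i)) hPYX (fun i y ↦ isPMF_ite_eq (sf i y))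
              fun _ _ _ _ _ ↦ rfl]
          ring
      _ ≤ mutInfo Q (fun ω ↦ ω.2.2.2.2) (fun ω ↦ ω.2.2.1) := hMI
      _ = mutInfo Q' (fun ω ↦ π ω.2.2.2.2) (fun ω ↦ ω.2.2.1) := mutInfo_eq_of_law hlaw _ _
      _ ≤ mutInfo Q' (fun ω ↦ ω.2.2.2.2) (fun ω ↦ ω.2.2.1) := mutInfo_comp_le hQ'_nonneg _ _ π


end
end
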